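/- arXiv:1502.04332 — 3 statements merged into one kernel-verified Lean document; each statement's English description precedes it below -/
import Mathlib

section
/- Let n ≥ 4 be an integer and p a prime. The degree of the diagonal matrix diag(1, p², …, p², p³, p³) (with n−3 entries equal to p²) equals p^{n+1}·(p^{n−2}−1)·(p^{n−1}−1)·(p^n−1)/((p−1)²·(p²−1)). -/
open Matrix

/-- `Λ_n = GL_n(ℤ)` viewed inside the `n × n` rational matrices: the matrices with integer
entries whose determinant is `±1`. -/
def Lambda (n : ℕ) : Set (Matrix (Fin n) (Fin n) ℚ) :=
  {γ | (∀ i j, ∃ z : ℤ, γ i j = (z : ℚ)) ∧ (γ.det = 1 ∨ γ.det = -1)}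

/-- The right coset `Λ_n h = {γ * h : γ ∈ Λ_n}`. -/
def rightCoset (n : ℕ) (h : Matrix (Fin n) (Fin n) ℚ) : Set (Matrix (Fin n) (Fin n) ℚ) :=
  {m | ∃ γ ∈ Lambda n, m = γ * h}

/-- The double coset `Λ_n g Λ_n = {γ₁ * g * γ₂ : γ₁, γ₂ ∈ Λ_n}`. -/
def doubleCoset (n : ℕ) (g : Matrix (Fin n) (Fin n) ℚ) : Set (Matrix (Fin n) (Fin n) ℚ) :=
  {m | ∃ γ₁ ∈ Lambda n, ∃ γ₂ ∈ Lambda n, m = γ₁ * g * γ₂}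

/-- The degree of `g`: the number of distinct right cosets `Λ_n h` contained in `Λ_n g Λ_n`. -/
noncomputable def degree (n : ℕ) (g : Matrix (Fin n) (Fin n) ℚ) : ℕ :=
  Set.ncard {S : Set (Matrix (Fin n) (Fin n) ℚ) | ∃ h ∈ doubleCoset n g, S = rightCoset n h}

/-- The `k`-th determinantal divisor of an `n × n` integer matrix: the gcd of all of its
`k × k` minors (which is `0` when all these minors vanish), a minor being indexed by a pair
of strictly increasing maps `Fin k → Fin n` selecting rows and columns. -/
def detDiv (n k : ℕ) (C : Matrix (Fin n) (Fin n) ℤ) : ℤ :=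
  Finset.gcd ((Finset.univ : Finset ((Fin k → Fin n) × (Fin k → Fin n))).filter
      (fun fg => (∀ a b : Fin k, a < b → fg.1 a < fg.1 b) ∧
        (∀ a b : Fin k, a < b → fg.2 a < fg.2 b)))
    (fun fg => (C.submatrix fg.1 fg.2).det)

/-- `D^(n)(p) = diag(1, p, …, p, p²)` with `n - 2` middle diagonal entries equal to `p`. -/
def Dmat (n p : ℕ) : Matrix (Fin n) (Fin n) ℤ :=
  Matrix.diagonal (fun i => if i.val = 0 then 1 else if i.val = n - 1 then (p : ℤ) ^ 2 else (p : ℤ))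

/-- The set `R₀^(n)(p)` of upper-triangular integer matrices whose determinantal divisors are
`d_k = p^(k-1)` for `1 ≤ k ≤ n - 1` and `d_n = p^n`, whose diagonal entries all equal `p`, and
whose above-diagonal entries lie in `[0, p)`. -/
def R0 (n p : ℕ) : Set (Matrix (Fin n) (Fin n) ℤ) :=
  {C | (∀ i j : Fin n, j < i → C i j = 0) ∧
    (∀ k : ℕ, 1 ≤ k → k ≤ n - 1 → detDiv n k C = (p : ℤ) ^ (k - 1)) ∧
    detDiv n n C = (p : ℤ) ^ n ∧
    (∀ i : Fin n, C i i = (p : ℤ)) ∧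
    (∀ i j : Fin n, i < j → 0 ≤ C i j ∧ C i j < (p : ℤ))}

/-- The set `R₁^(n)(p)` of upper-triangular integer matrices whose diagonal entries lie in
`{1, p, p²}` with exactly one entry `1` and exactly one entry `p²`, whose above-diagonal
entries satisfy `0 ≤ c i j < c j j`, and such that `p ∣ c i i` implies `p ∣ c i j` for `j > i`. -/
def R1 (n p : ℕ) : Set (Matrix (Fin n) (Fin n) ℤ) :=
  {C | (∀ i j : Fin n, j < i → C i j = 0) ∧
    (∀ i : Fin n, C i i = 1 ∨ C i i = (p : ℤ) ∨ C i i = (p : ℤ) ^ 2) ∧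
    (∃! i : Fin n, C i i = 1) ∧
    (∃! i : Fin n, C i i = (p : ℤ) ^ 2) ∧
    (∀ i j : Fin n, i < j → 0 ≤ C i j ∧ C i j < C j j) ∧
    (∀ i j : Fin n, i < j → (p : ℤ) ∣ C i i → (p : ℤ) ∣ C i j)}

/-- Casting an integer matrix to a rational matrix. -/
def toQ (n : ℕ) (C : Matrix (Fin n) (Fin n) ℤ) : Matrix (Fin n) (Fin n) ℚ :=
  C.map (fun z : ℤ => (z : ℚ))

namespace HeckeDegree

variable {p : ℕ} [Fact p.Prime]

theorem isUnit_castHom_iff {K : ℕ} (hK : K ≠ 0) (x : ZMod (p ^ K)) :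
    IsUnit (ZMod.castHom (dvd_pow_self p hK) (ZMod p) x) ↔ IsUnit x := by
  obtain ⟨m, rfl⟩ := ZMod.natCast_zmod_surjective x
  rw [map_natCast, ZMod.isUnit_iff_coprime, ZMod.isUnit_iff_coprime,
    Nat.coprime_pow_right_iff (Nat.pos_of_ne_zero hK)]

theorem card_pow_dvd {K d : ℕ} (hd : d ≤ K) :
    Nat.card {x : ZMod (p ^ K) // (p : ZMod (p ^ K)) ^ d ∣ x} = p ^ (K - d) := by
  have h : ∀ x : ZMod (p ^ K), (p : ZMod (p ^ K)) ^ d ∣ x ↔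
      x ∈ AddSubgroup.zmultiples ((p ^ d : ℕ) : ZMod (p ^ K)) := by
    intro x
    rw [AddSubgroup.mem_zmultiples_iff]
    constructor
    · rintro ⟨y, rfl⟩
      obtain ⟨k, rfl⟩ := ZMod.intCast_surjective y
      exact ⟨k, by simp [mul_comm]⟩
    · rintro ⟨k, rfl⟩
      exact ⟨(k : ZMod (p ^ K)), by simp [mul_comm]⟩
  rw [Nat.card_congr (Equiv.subtypeEquivRight h)]
  have hp := (Fact.out : p.Prime).pos
  change Nat.card (AddSubgroup.zmultiples ((p ^ d : ℕ) : ZMod (p ^ K))) = _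
  rw [Nat.card_zmultiples, ZMod.addOrderOf_coe _ (pow_pos hp K).ne',
    Nat.gcd_eq_right (pow_dvd_pow p hd), Nat.pow_div hd hp]

theorem castHom_eq_zero_iff {K : ℕ} (hK : K ≠ 0) (x : ZMod (p ^ K)) :
    ZMod.castHom (dvd_pow_self p hK) (ZMod p) x = 0 ↔ (p : ZMod (p ^ K)) ∣ x := by
  constructor
  · obtain ⟨m, rfl⟩ := ZMod.natCast_zmod_surjective x
    rw [map_natCast, ZMod.natCast_eq_zero_iff]
    exact fun h => Nat.cast_dvd_cast h
  · rintro ⟨y, rfl⟩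
    rw [map_mul, map_natCast, ZMod.natCast_self, zero_mul]

theorem card_lifts {K d : ℕ} (hK : K ≠ 0) (hd : d ≤ K) (a : ZMod p) (ha : d ≠ 0 → a = 0) :
    Nat.card {x : ZMod (p ^ K) // ZMod.castHom (dvd_pow_self p hK) (ZMod p) x = a ∧
      (p : ZMod (p ^ K)) ^ d ∣ x} = p ^ (K - max 1 d) := by
  rcases eq_or_ne d 0 with rfl | hd0
  · obtain ⟨b, rfl⟩ := ZMod.castHom_surjective (dvd_pow_self p hK) a
    rw [max_eq_left (Nat.zero_le 1), ← card_pow_dvd (p := p) (Nat.one_le_iff_ne_zero.2 hK)]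
    refine Nat.card_congr ((Equiv.subRight b).subtypeEquiv fun x => ?_)
    rw [pow_zero, pow_one, ← castHom_eq_zero_iff hK]
    simp only [isUnit_one, IsUnit.dvd, and_true, Equiv.subRight_apply, map_sub, sub_eq_zero]
  · rw [max_eq_right (Nat.one_le_iff_ne_zero.2 hd0), ← card_pow_dvd (p := p) hd]
    refine Nat.card_congr (Equiv.subtypeEquivRight fun x => ?_)
    rw [ha hd0, castHom_eq_zero_iff hK]
    exact and_iff_right_of_imp fun h => (dvd_pow_self _ hd0).trans h

/-- Invertible matrices `M` over `ℤ/p^K` with `p ^ (e j - e i) ∣ M i j`: the reductions of the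
elements of `GL_n(ℤ)` that stay integral under conjugation by `diag(p ^ e i)`. -/
def parahoric (p K : ℕ) {ι : Type*} [Fintype ι] [DecidableEq ι] (e : ι → ℕ) :
    Set (Matrix ι ι (ZMod (p ^ K))) :=
  {M | (∀ i j, (p : ZMod (p ^ K)) ^ (e j - e i) ∣ M i j) ∧ IsUnit M.det}

/-- Invertible matrices over `ℤ/p` with zero entries wherever the weight increases. -/
def parabolic (p : ℕ) {ι : Type*} [Fintype ι] [DecidableEq ι] (e : ι → ℕ) :
    Set (Matrix ι ι (ZMod p)) :=
  {M | (∀ i j, e i < e j → M i j = 0) ∧ IsUnit M.det}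

theorem card_parahoric {K : ℕ} (hK : K ≠ 0) {ι : Type*} [Fintype ι] [DecidableEq ι]
    (e : ι → ℕ) (he : ∀ i, e i ≤ K) :
    Nat.card (parahoric p K e) =
      Nat.card (parabolic p e) * ∏ i, ∏ j, p ^ (K - max 1 (e j - e i)) := by
  set π := ZMod.castHom (dvd_pow_self p hK) (ZMod p)
  have hdet : ∀ M : Matrix ι ι (ZMod (p ^ K)), IsUnit (M.map π).det ↔ IsUnit M.det := by
    intro M
    rw [← isUnit_castHom_iff hK M.det, RingHom.map_det]
    rfl
  have hzero : ∀ {x : ZMod (p ^ K)} {d : ℕ}, d ≠ 0 → (p : ZMod (p ^ K)) ^ d ∣ x → π x = 0 :=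
    fun hd h => (castHom_eq_zero_iff hK _).2 ((dvd_pow_self _ hd).trans h)
  let E : parahoric p K e ≃ Σ N : parabolic p e, ∀ i j,
      {x : ZMod (p ^ K) // π x = N.1 i j ∧ (p : ZMod (p ^ K)) ^ (e j - e i) ∣ x} :=
    { toFun := fun M => ⟨⟨M.1.map π, fun i j h => hzero (Nat.sub_ne_zero_of_lt h) (M.2.1 i j),
        (hdet _).2 M.2.2⟩, fun i j => ⟨M.1 i j, rfl, M.2.1 i j⟩⟩
      invFun := fun N => ⟨Matrix.of fun i j => (N.2 i j).1, fun i j => (N.2 i j).2.2, by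
        rw [← hdet]
        convert N.1.2.2
        ext i j
        exact (N.2 i j).2.1⟩
      left_inv := fun M => rfl
      right_inv := by
        rintro ⟨⟨N, hN⟩, f⟩
        obtain ⟨F, hF, rfl⟩ : ∃ (F : ι → ι → ZMod (p ^ K)) (hF : ∀ i j, π (F i j) = N i j ∧
            (p : ZMod (p ^ K)) ^ (e j - e i) ∣ F i j), f = fun i j => ⟨F i j, hF i j⟩ :=
          ⟨fun i j => (f i j).1, fun i j => (f i j).2, rfl⟩
        obtain rfl : (Matrix.of F).map π = N := by
          ext i j
          exact (hF i j).1
        rfl }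
  have := Fintype.ofFinite (parabolic p e)
  rw [Nat.card_congr E, Nat.card_sigma]
  have : ∀ N : parabolic p e, Nat.card (∀ i j,
      {x : ZMod (p ^ K) // π x = N.1 i j ∧ (p : ZMod (p ^ K)) ^ (e j - e i) ∣ x}) =
        ∏ i, ∏ j, p ^ (K - max 1 (e j - e i)) := by
    intro N
    rw [Nat.card_pi]
    refine Finset.prod_congr rfl fun i _ => ?_
    rw [Nat.card_pi]
    exact Finset.prod_congr rfl fun j _ => card_lifts hK ((Nat.sub_le _ _).trans (he j)) _
      fun h => N.2.1 i j (by lia)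
  simp only [this]
  rw [Finset.sum_const, smul_eq_mul, Finset.card_univ, Nat.card_eq_fintype_card]

theorem card_isUnit_det (a R : Type*) [Fintype a] [DecidableEq a] [CommRing R] :
    Nat.card {A : Matrix a a R // IsUnit A.det} = Nat.card (GL a R) :=
  Nat.card_congr
    { toFun := fun A => Matrix.nonsingInvUnit A.1 A.2
      invFun := fun A => ⟨A.1, (Matrix.isUnit_iff_isUnit_det _).1 A.isUnit⟩
      left_inv := fun _ => rfl
      right_inv := fun _ => Units.ext rfl }

theorem card_parabolic_sum {a b : Type*} [Fintype a] [DecidableEq a] [Fintype b] [DecidableEq b]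
    (s : ℕ) (e : b → ℕ) (he : ∀ i, s < e i) :
    Nat.card (parabolic p (Sum.elim (fun _ : a => s) e)) =
      Nat.card (GL a (ZMod p)) * Nat.card (parabolic p e) *
        p ^ (Fintype.card b * Fintype.card a) := by
  let E : parabolic p (Sum.elim (fun _ : a => s) e) ≃
      {A : Matrix a a (ZMod p) // IsUnit A.det} × parabolic p e × Matrix b a (ZMod p) :=
    { toFun := fun M => by
        have h : M.1 = fromBlocks M.1.toBlocks₁₁ 0 M.1.toBlocks₂₁ M.1.toBlocks₂₂ := by
          conv_lhs => rw [← fromBlocks_toBlocks M.1]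
          congr 1
          ext i j
          exact M.2.1 (Sum.inl i) (Sum.inr j) (he j)
        have hu : IsUnit (M.1.toBlocks₁₁.det * M.1.toBlocks₂₂.det) := by
          rw [← det_fromBlocks_zero₁₂ _ M.1.toBlocks₂₁, ← h]
          exact M.2.2
        exact ⟨⟨M.1.toBlocks₁₁, isUnit_of_mul_isUnit_left hu⟩, ⟨M.1.toBlocks₂₂,
          fun i j hij => M.2.1 (Sum.inr i) (Sum.inr j) hij, isUnit_of_mul_isUnit_right hu⟩,
          M.1.toBlocks₂₁⟩
      invFun := fun N => ⟨fromBlocks N.1.1 0 N.2.2 N.2.1.1, by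
        rintro (i | i) (j | j) hij
        · exact absurd hij (lt_irrefl _)
        · rfl
        · exact absurd hij (he i).not_gt
        · exact N.2.1.2.1 i j hij, by
        rw [det_fromBlocks_zero₁₂]
        exact N.1.2.mul N.2.1.2.2⟩
      left_inv := by
        rintro ⟨M, hM⟩
        refine Subtype.ext ?_
        ext (i | i) (j | j)
        · rfl
        · exact (hM.1 (Sum.inl i) (Sum.inr j) (he j)).symm
        · rfl
        · rfl
      right_inv := fun N => rfl }
  rw [Nat.card_congr E, Nat.card_prod, Nat.card_prod, ← mul_assoc]
  congr 2
  · exact card_isUnit_det a (ZMod p)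
  · change Nat.card (b → a → ZMod p) = _
    simp [Nat.card_eq_fintype_card, ZMod.card, ← pow_mul, mul_comm]

theorem card_parabolic_const {a : Type*} [Fintype a] [DecidableEq a] (s : ℕ) :
    Nat.card (parabolic p (fun _ : a => s)) = Nat.card (GL a (ZMod p)) := by
  rw [← card_isUnit_det]
  exact Nat.card_congr (Equiv.subtypeEquivRight fun A =>
    and_iff_right fun i j h => absurd h (lt_irrefl _))

/-- The matrices in `parahoric p K e` form a subgroup of the general linear group. -/
def parahoricSubgroup (p K : ℕ) [Fact p.Prime] {ι : Type*} [Fintype ι] [DecidableEq ι]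
    (e : ι → ℕ) : Subgroup (GL ι (ZMod (p ^ K))) :=
  let S : Submonoid (GL ι (ZMod (p ^ K))) :=
    { carrier := {M | ∀ i j, (p : ZMod (p ^ K)) ^ (e j - e i) ∣ M i j}
      one_mem' := by
        intro i j
        rcases eq_or_ne i j with rfl | h
        · simp
        · simp [h]
      mul_mem' := by
        intro A B hA hB i j
        rw [Units.val_mul, Matrix.mul_apply]
        refine Finset.dvd_sum fun k _ => ?_
        refine (pow_dvd_pow _ (?_ : e j - e i ≤ (e k - e i) + (e j - e k))).trans ?_
        · lia
        · rw [pow_add]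
          exact mul_dvd_mul (hA i k) (hB k j) }
  { S with
    inv_mem' := by
      intro M hM
      have h : M⁻¹ = M ^ (Nat.card (GL ι (ZMod (p ^ K))) - 1) := by
        rw [inv_eq_iff_mul_eq_one, ← pow_succ', Nat.sub_add_cancel Nat.card_pos, pow_card_eq_one']
      exact h ▸ S.pow_mem hM _ }

theorem mem_parahoricSubgroup {K : ℕ} {ι : Type*} [Fintype ι] [DecidableEq ι] {e : ι → ℕ}
    {M : GL ι (ZMod (p ^ K))} :
    M ∈ parahoricSubgroup p K e ↔ ∀ i j, (p : ZMod (p ^ K)) ^ (e j - e i) ∣ M i j :=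
  Iff.rfl

theorem card_parahoricSubgroup {K : ℕ} {ι : Type*} [Fintype ι] [DecidableEq ι] (e : ι → ℕ) :
    Nat.card (parahoricSubgroup p K e) = Nat.card (parahoric p K e) :=
  Nat.card_congr
    { toFun := fun A => ⟨A.1, A.2, (Matrix.isUnit_iff_isUnit_det _).1 A.1.isUnit⟩
      invFun := fun A => ⟨Matrix.nonsingInvUnit A.1 A.2.2, A.2.1⟩
      left_inv := fun _ => Subtype.ext (Units.ext rfl)
      right_inv := fun _ => rfl }

theorem exists_associated_pow {K : ℕ} (x : ZMod (p ^ K)) :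
    ∃ s, Associated x ((p : ZMod (p ^ K)) ^ s) := by
  have hp : p.Prime := Fact.out
  obtain ⟨m, rfl⟩ := ZMod.natCast_zmod_surjective x
  rcases eq_or_ne m 0 with rfl | hm
  · refine ⟨K, ?_⟩
    rw [Nat.cast_zero, ← Nat.cast_pow, ZMod.natCast_self]
  · obtain ⟨s, u, hu, rfl⟩ := Nat.exists_eq_pow_mul_and_not_dvd hm p hp.ne_one
    have hu' : IsUnit (u : ZMod (p ^ K)) :=
      (ZMod.isUnit_iff_coprime _ _).2 (((hp.coprime_iff_not_dvd.2 hu).symm).pow_right K)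
    exact ⟨s, by
      rw [Nat.cast_mul, Nat.cast_pow]
      exact associated_mul_unit_left _ _ hu'⟩

theorem exists_forall_dvd {K : ℕ} {ι : Type*} (s : Finset ι) (hs : s.Nonempty)
    (f : ι → ZMod (p ^ K)) : ∃ i ∈ s, ∀ j ∈ s, f i ∣ f j := by
  choose v hv using fun i => exists_associated_pow (f i)
  obtain ⟨i, hi, h⟩ := s.exists_min_image v hs
  exact ⟨i, hi, fun j hj => (hv i).dvd.trans ((pow_dvd_pow _ (h j hj)).trans (hv j).symm.dvd)⟩

/-- The permutation matrix of `σ` as an invertible matrix. -/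
noncomputable def permGL {ι : Type*} [Fintype ι] [DecidableEq ι] (σ : Equiv.Perm ι) : GL ι ℤ :=
  Matrix.nonsingInvUnit (σ.permMatrix ℤ) (by
    rw [Matrix.det_permutation]
    exact (Equiv.Perm.sign σ).isUnit.map (Int.castRingHom ℤ))

/-- Reduction of integral invertible matrices modulo `p ^ K`. -/
def reduction (p K : ℕ) (ι : Type*) [Fintype ι] [DecidableEq ι] :
    GL ι ℤ →* GL ι (ZMod (p ^ K)) :=
  Matrix.GeneralLinearGroup.map (Int.castRingHom (ZMod (p ^ K)))

theorem reduction_apply {p K : ℕ} {ι : Type*} [Fintype ι] [DecidableEq ι] (γ : GL ι ℤ) (i j : ι) :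
    reduction p K ι γ i j = ((γ i j : ℤ) : ZMod (p ^ K)) :=
  rfl

theorem mul_permGL_apply {p K : ℕ} {ι : Type*} [Fintype ι] [DecidableEq ι]
    (M : GL ι (ZMod (p ^ K))) (σ : Equiv.Perm ι) (i j : ι) :
    (M * reduction p K ι (permGL σ)) i j = M i (σ.symm j) := by
  have h : ∀ k, reduction p K ι (permGL σ) k j = if σ k = j then 1 else 0 := by
    intro k
    rw [reduction_apply]
    change (((σ.permMatrix ℤ) k j : ℤ) : ZMod (p ^ K)) = _
    simp [Equiv.Perm.permMatrix, PEquiv.toMatrix_apply, Equiv.toPEquiv_apply, eq_comm]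
  rw [Units.val_mul, Matrix.mul_apply, Finset.sum_eq_single (σ.symm j)]
  · rw [h, Equiv.apply_symm_apply, if_pos rfl, mul_one]
  · intro k _ hk
    rw [h, if_neg fun h => hk (by rw [← h, Equiv.symm_apply_apply]), mul_zero]
  · simp

/-- The column operation subtracting `c j` times column `k` from column `j` for all `j > k`. -/
noncomputable def clearGL {n : ℕ} (k : Fin n) (c : Fin n → ℤ) : GL (Fin n) ℤ :=
  Matrix.nonsingInvUnit (1 - Matrix.of fun i j => if i = k ∧ k < j then c j else 0) (by
    rw [Matrix.det_of_isUpperTriangular]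
    · rw [Finset.prod_eq_one]
      · exact isUnit_one
      · intro i _
        rw [Matrix.sub_apply, Matrix.one_apply_eq, Matrix.of_apply,
          if_neg (by rintro ⟨rfl, h⟩; exact lt_irrefl _ h), sub_zero]
    · intro i j hij
      have hij' : j < i := hij
      simp only [Matrix.sub_apply, Matrix.of_apply, Matrix.one_apply_ne hij'.ne']
      rw [if_neg (by rintro ⟨rfl, h⟩; exact absurd h hij'.not_gt), sub_zero])

theorem mul_clearGL_apply {p K n : ℕ} (M : GL (Fin n) (ZMod (p ^ K))) (k : Fin n) (c : Fin n → ℤ)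
    (i j : Fin n) : (M * reduction p K _ (clearGL k c)) i j =
      M i j - if k < j then M i k * (c j : ZMod (p ^ K)) else 0 := by
  have h : ((reduction p K _ (clearGL k c) : GL (Fin n) (ZMod (p ^ K))) : Matrix _ _ _) =
      1 - Matrix.of fun i j => if i = k ∧ k < j then (c j : ZMod (p ^ K)) else 0 := by
    ext i j
    rw [reduction_apply]
    change (((1 - Matrix.of fun i j => if i = k ∧ k < j then c j else 0 :
      Matrix (Fin n) (Fin n) ℤ) i j : ℤ) : ZMod (p ^ K)) = _
    simp only [Matrix.sub_apply, Matrix.of_apply, Matrix.one_apply]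
    push_cast
    rfl
  rw [Units.val_mul, h, mul_sub, mul_one, Matrix.sub_apply, Matrix.mul_apply]
  congr 1
  rw [Finset.sum_eq_single k]
  · by_cases hkj : k < j <;> simp [hkj]
  · intro l _ hl
    simp [hl]
  · simp

/-- Integral column operations bring any invertible matrix over `ℤ/p^K` to lower triangular
form. -/
theorem exists_lowerTriangular {K n : ℕ} (M : GL (Fin n) (ZMod (p ^ K))) :
    ∃ γ : GL (Fin n) ℤ, ∀ i j, i < j → (M * reduction p K _ γ) i j = 0 := by
  suffices h : ∀ m : ℕ, ∃ γ : GL (Fin n) ℤ, ∀ i j : Fin n, i.val < m → i < j →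
      (M * reduction p K _ γ) i j = 0 by
    obtain ⟨γ, hγ⟩ := h n
    exact ⟨γ, fun i j => hγ i j i.isLt⟩
  intro m
  induction m with
  | zero => exact ⟨1, fun i j h => absurd h (Nat.not_lt_zero _)⟩
  | succ m ih =>
    obtain ⟨γ, hγ⟩ := ih
    by_cases hm : m < n
    swap
    · exact ⟨γ, fun i j _ => hγ i j (by lia)⟩
    set k : Fin n := ⟨m, hm⟩ with hk
    set N := M * reduction p K _ γ with hN
    obtain ⟨l, hl, hdvd⟩ := exists_forall_dvd (Finset.Ici k) ⟨k, Finset.mem_Ici.2 le_rfl⟩ (N k)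
    rw [Finset.mem_Ici] at hl
    set N' := N * reduction p K _ (permGL (Equiv.swap k l)) with hN'
    have hN'apply : ∀ i j, N' i j = N i (Equiv.swap k l j) := fun i j => by
      rw [hN', mul_permGL_apply, Equiv.symm_swap]
    have hle : ∀ j, k ≤ j → k ≤ Equiv.swap k l j := by
      intro j hj
      rw [Equiv.swap_apply_def]
      split_ifs <;> first | assumption | exact le_rfl
    have hzero : ∀ i j : Fin n, i.val < m → i < j → N' i j = 0 := by
      intro i j him hij
      rw [hN'apply]
      refine hγ _ _ him ?_
      rcases le_or_gt k j with h | h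
      · exact lt_of_lt_of_le (show i < k from him) (hle j h)
      · rwa [Equiv.swap_apply_of_ne_of_ne h.ne (h.trans_le hl).ne]
    have hc : ∀ j, ∃ c : ℤ, k < j → N' k j = N' k k * (c : ZMod (p ^ K)) := by
      intro j
      by_cases hj : k < j
      · obtain ⟨c, hc⟩ := hdvd _ (Finset.mem_Ici.2 (hle j hj.le))
        obtain ⟨c, rfl⟩ := ZMod.intCast_surjective c
        exact ⟨c, fun _ => by rw [hN'apply, hN'apply, Equiv.swap_apply_left, hc]⟩
      · exact ⟨0, fun h => absurd h hj⟩
    choose c hc using hc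
    refine ⟨γ * permGL (Equiv.swap k l) * clearGL k c, fun i j him hij => ?_⟩
    rw [map_mul, map_mul, ← mul_assoc, ← mul_assoc, mul_clearGL_apply]
    change N' i j - (if k < j then N' i k * _ else 0) = 0
    rcases Nat.lt_succ_iff_lt_or_eq.1 him with h | h
    · rw [hzero i j h hij, hzero i k h h, zero_mul, ite_self, sub_zero]
    · obtain rfl : i = k := Fin.ext h
      rw [if_pos hij, hc j hij, sub_self]

theorem index_comap_reduction {K n : ℕ} {e : Fin n → ℕ} (he : Monotone e) :
    ((parahoricSubgroup p K e).comap (reduction p K (Fin n))).index =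
      (parahoricSubgroup p K e).index := by
  rw [Subgroup.index_comap]
  set P := parahoricSubgroup p K e
  refine Nat.card_congr (Equiv.ofBijective
    (fun x : (reduction p K (Fin n)).range ⧸ P.subgroupOf (reduction p K (Fin n)).range =>
      (Quotient.map' (s₁ := QuotientGroup.leftRel _) (s₂ := QuotientGroup.leftRel P)
        Subtype.val ?_ x : GL (Fin n) (ZMod (p ^ K)) ⧸ P)) ⟨?_, ?_⟩)
  · intro a b h
    rw [QuotientGroup.leftRel_apply] at h ⊢
    exact h
  · rintro ⟨a⟩ ⟨b⟩ h
    exact QuotientGroup.eq.2 (QuotientGroup.eq.1 h : (a : GL (Fin n) (ZMod (p ^ K)))⁻¹ * b ∈ P)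
  · rintro ⟨M⟩
    obtain ⟨γ, hγ⟩ := exists_lowerTriangular M⁻¹
    refine ⟨QuotientGroup.mk ⟨reduction p K _ γ, γ, rfl⟩, QuotientGroup.eq.2 ?_⟩
    change (reduction p K _ γ)⁻¹ * M ∈ P
    rw [← inv_mem_iff, _root_.mul_inv_rev, inv_inv]
    intro i j
    rcases lt_or_ge i j with h | h
    · rw [hγ i j h]
      exact dvd_zero _
    · rw [Nat.sub_eq_zero_of_le (he h), pow_zero]
      exact one_dvd _

/-- Integral invertible matrices as rational ones. -/
def toRat {n : ℕ} : GL (Fin n) ℤ →* GL (Fin n) ℚ :=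
  Matrix.GeneralLinearGroup.map (Int.castRingHom ℚ)

theorem toRat_apply {n : ℕ} (γ : GL (Fin n) ℤ) (i j : Fin n) : toRat γ i j = (γ i j : ℚ) :=
  rfl

theorem det_map_intCast {n : ℕ} (A : Matrix (Fin n) (Fin n) ℤ) :
    (A.map (Int.castRingHom ℚ)).det = A.det :=
  (RingHom.map_det (Int.castRingHom ℚ) A).symm

theorem mem_Lambda_iff {n : ℕ} {A : Matrix (Fin n) (Fin n) ℚ} :
    A ∈ Lambda n ↔ ∃ γ : GL (Fin n) ℤ, (toRat γ : Matrix (Fin n) (Fin n) ℚ) = A := by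
  constructor
  · rintro ⟨hA, hdet⟩
    choose B hB using hA
    obtain rfl : (Matrix.of B).map (Int.castRingHom ℚ) = A := by
      ext i j
      exact (hB i j).symm
    rw [det_map_intCast] at hdet
    have : IsUnit (Matrix.of B).det := by
      rw [Int.isUnit_iff]
      exact_mod_cast hdet
    exact ⟨Matrix.nonsingInvUnit _ this, rfl⟩
  · rintro ⟨γ, rfl⟩
    refine ⟨fun i j => ⟨γ i j, rfl⟩, ?_⟩
    change (γ.1.map (Int.castRingHom ℚ)).det = 1 ∨ (γ.1.map (Int.castRingHom ℚ)).det = -1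
    rw [det_map_intCast]
    have h := Int.isUnit_iff.1 ((Matrix.isUnit_iff_isUnit_det _).1 γ.isUnit)
    exact_mod_cast h

theorem rightCoset_mul {n : ℕ} (γ : GL (Fin n) ℤ) (h : Matrix (Fin n) (Fin n) ℚ) :
    rightCoset n (toRat γ * h) = rightCoset n h := by
  ext m
  simp only [rightCoset, mem_Lambda_iff, Set.mem_ofPred_eq, exists_exists_eq_and]
  constructor
  · rintro ⟨δ, rfl⟩
    exact ⟨δ * γ, by rw [map_mul, Units.val_mul, mul_assoc]⟩
  · rintro ⟨δ, rfl⟩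
    exact ⟨δ * γ⁻¹, by
      rw [← mul_assoc, ← Units.val_mul, ← map_mul, inv_mul_cancel_right]⟩

theorem rightCoset_eq_iff {n : ℕ} {g h : Matrix (Fin n) (Fin n) ℚ} :
    rightCoset n g = rightCoset n h ↔
      ∃ γ : GL (Fin n) ℤ, g = toRat γ * h := by
  constructor
  · intro hgh
    have : g ∈ rightCoset n g := ⟨1, mem_Lambda_iff.2 ⟨1, by simp⟩, by simp⟩
    rw [hgh] at this
    obtain ⟨γ, hγ, rfl⟩ := this
    obtain ⟨γ, rfl⟩ := mem_Lambda_iff.1 hγ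
    exact ⟨γ, rfl⟩
  · rintro ⟨γ, rfl⟩
    exact rightCoset_mul γ h

/-- The condition for an integral matrix to stay integral after conjugation by
`diag(p ^ e i)`. -/
theorem exists_conj_iff {K n : ℕ} {e : Fin n → ℕ} (he : ∀ i, e i ≤ K) (γ : GL (Fin n) ℤ) :
    (∃ δ : GL (Fin n) ℤ, Matrix.diagonal (fun i => (p : ℚ) ^ e i) * (toRat γ).1 =
      toRat δ * Matrix.diagonal fun i => (p : ℚ) ^ e i) ↔
      reduction p K _ γ ∈ parahoricSubgroup p K e := by
  have hp0 : (p : ℚ) ≠ 0 := Nat.cast_ne_zero.2 (Fact.out : p.Prime).ne_zero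
  have hp0' : (p : ℤ) ≠ 0 := Nat.cast_ne_zero.2 (Fact.out : p.Prime).ne_zero
  have hmem : reduction p K _ γ ∈ parahoricSubgroup p K e ↔
      ∀ i j, (p : ℤ) ^ (e j - e i) ∣ γ i j := by
    rw [mem_parahoricSubgroup]
    refine forall_congr' fun i => forall_congr' fun j => ?_
    rw [reduction_apply]
    constructor
    · rintro ⟨c, hc⟩
      obtain ⟨c, rfl⟩ := ZMod.intCast_surjective c
      have h : ((γ i j - (p : ℤ) ^ (e j - e i) * c : ℤ) : ZMod (p ^ K)) = 0 := by
        push_cast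
        rw [hc, sub_self]
      rw [ZMod.intCast_zmod_eq_zero_iff_dvd, Nat.cast_pow] at h
      exact (dvd_sub_left (dvd_mul_right _ _)).1
        ((pow_dvd_pow _ ((Nat.sub_le _ _).trans (he j))).trans h)
    · rintro ⟨c, hc⟩
      exact ⟨(c : ZMod (p ^ K)), by rw [hc]; push_cast; rfl⟩
  rw [hmem]
  constructor
  · rintro ⟨δ, hδ⟩ i j
    have h := congrFun (congrFun hδ i) j
    rw [Matrix.diagonal_mul, Matrix.mul_diagonal, toRat_apply, toRat_apply] at h
    have h' : (p : ℤ) ^ e i * γ i j = δ i j * (p : ℤ) ^ e j := by exact_mod_cast h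
    rcases le_total (e j) (e i) with hij | hij
    · rw [Nat.sub_eq_zero_of_le hij, pow_zero]
      exact one_dvd _
    · refine ⟨δ i j, mul_left_cancel₀ (pow_ne_zero (e i) hp0') ?_⟩
      rw [h', ← mul_assoc, ← pow_add, Nat.add_sub_cancel' hij, mul_comm]
  · intro h
    have hint : ∀ i j, ∃ z : ℤ, (p : ℚ) ^ e i * γ i j = z * (p : ℚ) ^ e j := by
      intro i j
      obtain ⟨c, hc⟩ := h i j
      refine ⟨(p : ℤ) ^ (e i - e j) * c, ?_⟩
      rw [hc]
      push_cast
      rw [← mul_assoc, ← pow_add, mul_right_comm, ← pow_add]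
      congr 2
      lia
    set D : Matrix (Fin n) (Fin n) ℚ := Matrix.diagonal fun i => (p : ℚ) ^ e i with hD
    choose B hB using hint
    have hBD : D * (toRat γ).1 = (Matrix.of B).map (Int.castRingHom ℚ) * D := by
      ext i j
      rw [hD, Matrix.diagonal_mul, Matrix.mul_diagonal]
      exact hB i j
    have hD0 : D.det ≠ 0 := by
      rw [hD, Matrix.det_diagonal]
      exact Finset.prod_ne_zero_iff.2 fun i _ => pow_ne_zero _ hp0
    have hdet : (Matrix.of B).det = γ.1.det := by
      have := congrArg Matrix.det hBD
      rw [Matrix.det_mul, Matrix.det_mul, mul_comm, det_map_intCast] at this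
      have h2 := mul_right_cancel₀ hD0 this
      change (γ.1.map (Int.castRingHom ℚ)).det = _ at h2
      rw [det_map_intCast] at h2
      exact_mod_cast h2.symm
    exact ⟨Matrix.nonsingInvUnit (Matrix.of B)
      (hdet ▸ (Matrix.isUnit_iff_isUnit_det _).1 γ.isUnit), hBD⟩

theorem degree_diagonal {K n : ℕ} {e : Fin n → ℕ} (he : ∀ i, e i ≤ K) (hmono : Monotone e) :
    degree n (Matrix.diagonal fun i => (p : ℚ) ^ e i) = (parahoricSubgroup p K e).index := by
  rw [← index_comap_reduction hmono]
  set D : Matrix (Fin n) (Fin n) ℚ := Matrix.diagonal fun i => (p : ℚ) ^ e i with hD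
  set H := (parahoricSubgroup p K e).comap (reduction p K (Fin n)) with hH
  have hkey : ∀ γ γ' : GL (Fin n) ℤ,
      rightCoset n (D * (toRat γ⁻¹).1) = rightCoset n (D * (toRat γ'⁻¹).1) ↔ γ⁻¹ * γ' ∈ H := by
    intro γ γ'
    rw [rightCoset_eq_iff, hH, Subgroup.mem_comap, ← exists_conj_iff he]
    refine exists_congr fun δ => ?_
    rw [map_inv toRat γ', ← mul_assoc, Units.eq_mul_inv_iff_mul_eq, map_mul, Units.val_mul,
      ← mul_assoc]
  have hset : {S | ∃ h ∈ doubleCoset n D, S = rightCoset n h} =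
      Set.range fun γ : GL (Fin n) ℤ => rightCoset n (D * (toRat γ⁻¹).1) := by
    ext S
    constructor
    · rintro ⟨_, ⟨γ₁, h₁, γ₂, h₂, rfl⟩, rfl⟩
      obtain ⟨γ₁, rfl⟩ := mem_Lambda_iff.1 h₁
      obtain ⟨γ₂, rfl⟩ := mem_Lambda_iff.1 h₂
      refine ⟨γ₂⁻¹, ?_⟩
      dsimp only
      rw [inv_inv, mul_assoc, rightCoset_mul]
    · rintro ⟨γ, rfl⟩
      exact ⟨_, ⟨1, mem_Lambda_iff.2 ⟨1, by simp⟩, _, mem_Lambda_iff.2 ⟨γ⁻¹, rfl⟩, rfl⟩,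
        by rw [one_mul]⟩
  rw [degree, hset, ← Nat.card_coe_set_eq]
  refine (Nat.card_congr (Equiv.ofBijective (fun x : GL (Fin n) ℤ ⧸ H =>
    Quotient.liftOn' x (fun γ => (⟨_, γ, rfl⟩ :
      Set.range fun γ : GL (Fin n) ℤ => rightCoset n (D * (toRat γ⁻¹).1))) ?_) ⟨?_, ?_⟩)).symm
  · intro a b h
    exact Subtype.ext ((hkey a b).2 (QuotientGroup.leftRel_apply.1 h))
  · rintro ⟨a⟩ ⟨b⟩ h
    exact QuotientGroup.eq.2 ((hkey a b).1 (Subtype.ext_iff.1 h))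
  · rintro ⟨_, γ, rfl⟩
    exact ⟨QuotientGroup.mk γ, rfl⟩

theorem card_parahoric_reindex {p K : ℕ} {ι κ : Type*} [Fintype ι] [DecidableEq ι] [Fintype κ]
    [DecidableEq κ] (σ : ι ≃ κ) (e : κ → ℕ) :
    Nat.card (parahoric p K (e ∘ σ)) = Nat.card (parahoric p K e) := by
  refine Nat.card_congr ((Matrix.reindex σ σ).subtypeEquiv fun M => ?_)
  refine and_congr ⟨fun h i j => ?_, fun h i j => ?_⟩ ?_
  · simpa using h (σ.symm i) (σ.symm j)
  · simpa using h (σ i) (σ j)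
  · rw [Matrix.det_reindex_self]

theorem card_GL_zmod_pow {K : ℕ} (hK : K ≠ 0) (n : ℕ) :
    Nat.card (GL (Fin n) (ZMod (p ^ K))) =
      Nat.card (GL (Fin n) (ZMod p)) * p ^ ((K - 1) * (n * n)) := by
  have h := card_parahoric (p := p) hK (fun _ : Fin n => 0) fun _ => Nat.zero_le _
  rw [card_parabolic_const] at h
  rw [← card_isUnit_det]
  refine Eq.trans (Nat.card_congr (Equiv.subtypeEquivRight fun M => ?_)) (h.trans ?_)
  · exact (and_iff_right fun i j => by simp).symm
  · simp [← pow_mul, mul_assoc]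

theorem card_GL_succ (n : ℕ) :
    (Nat.card (GL (Fin (n + 1)) (ZMod p)) : ℚ) =
      ((p : ℚ) ^ (n + 1) - 1) * (p : ℚ) ^ n * Nat.card (GL (Fin n) (ZMod p)) := by
  have hp := (Fact.out : p.Prime).pos
  have h : ∀ m : ℕ, (Nat.card (GL (Fin m) (ZMod p)) : ℚ) =
      ∏ i : Fin m, ((p : ℚ) ^ m - (p : ℚ) ^ (i : ℕ)) := by
    intro m
    rw [Matrix.card_GL_field, ZMod.card, Nat.cast_prod]
    refine Finset.prod_congr rfl fun i _ => ?_
    rw [Nat.cast_sub (Nat.pow_le_pow_right hp i.isLt.le), Nat.cast_pow, Nat.cast_pow]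
  rw [h, h, Fin.prod_univ_succ, Fin.val_zero, pow_zero, mul_assoc]
  congr 1
  have h2 : ∀ i : Fin n, (p : ℚ) ^ (n + 1) - (p : ℚ) ^ (i.succ : ℕ) =
      p * ((p : ℚ) ^ n - (p : ℚ) ^ (i : ℕ)) := fun i => by
    rw [Fin.val_succ]
    ring
  rw [Finset.prod_congr rfl fun i _ => h2 i, Finset.prod_mul_distrib]
  simp

/-- The exponents of `p` in `diag(1, p², …, p², p³, p³)`. -/
def exponent (n : ℕ) (i : Fin n) : ℕ :=
  if i.val = 0 then 0 else if n - 2 ≤ i.val then 3 else 2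

theorem exponent_le (n : ℕ) (i : Fin n) : exponent n i ≤ 3 := by
  unfold exponent
  split_ifs <;> lia

theorem monotone_exponent (n : ℕ) : Monotone (exponent n) := by
  intro i j hij
  have : i.val ≤ j.val := hij
  unfold exponent
  split_ifs <;> lia

theorem card_parahoric_exponent (m : ℕ) :
    Nat.card (parahoric p 3 (exponent (1 + (m + 2)))) =
      Nat.card (GL (Fin 1) (ZMod p)) *
        (Nat.card (GL (Fin m) (ZMod p)) * Nat.card (GL (Fin 2) (ZMod p)) * p ^ (2 * m)) *
        p ^ (m + 2) * p ^ (2 * m ^ 2 + 11 * m + 14) := by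
  have hexp : exponent (1 + (m + 2)) ∘
      ((Equiv.sumCongr (Equiv.refl _) finSumFinEquiv).trans finSumFinEquiv) =
      Sum.elim (fun _ : Fin 1 => 0) (Sum.elim (fun _ : Fin m => 2) fun _ : Fin 2 => 3) := by
    funext x
    rcases x with i | i | i
    · simp [exponent]
    · have := i.isLt
      simp only [exponent, Function.comp_apply, Equiv.trans_apply, Equiv.sumCongr_apply,
        Sum.map_inr, finSumFinEquiv_apply_left, finSumFinEquiv_apply_right, Sum.elim_inr,
        Sum.elim_inl, Fin.val_natAdd, Fin.val_castAdd]
      rw [if_neg (by lia), if_neg (by lia)]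
    · simp only [exponent, Function.comp_apply, Equiv.trans_apply, Equiv.sumCongr_apply,
        Sum.map_inr, finSumFinEquiv_apply_right, Sum.elim_inr, Fin.val_natAdd]
      rw [if_neg (by lia), if_pos (by lia)]
  rw [← card_parahoric_reindex
      ((Equiv.sumCongr (Equiv.refl _) finSumFinEquiv).trans finSumFinEquiv), hexp,
    card_parahoric three_ne_zero _ (by rintro (i | i | i) <;> simp),
    card_parabolic_sum 0 _ (by rintro (i | i) <;> simp),
    card_parabolic_sum 2 _ (by simp), card_parabolic_const]
  simp [Fintype.prod_sum_type, -mul_eq_mul_left_iff, -mul_eq_mul_right_iff]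
  ring

end HeckeDegree

theorem statement5 (n p : ℕ) (hn : 4 ≤ n) (hp : p.Prime) :
    (degree n (Matrix.diagonal fun i : Fin n =>
      if i.val = 0 then (1 : ℚ) else if n - 2 ≤ i.val then (p : ℚ) ^ 3 else (p : ℚ) ^ 2) : ℚ) =
      (p : ℚ) ^ (n + 1) * ((p : ℚ) ^ (n - 2) - 1) * ((p : ℚ) ^ (n - 1) - 1) * ((p : ℚ) ^ n - 1)
        / (((p : ℚ) - 1) ^ 2 * ((p : ℚ) ^ 2 - 1)) := by
  have : Fact p.Prime := ⟨hp⟩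
  have hfun : (fun i : Fin n =>
      if i.val = 0 then (1 : ℚ) else if n - 2 ≤ i.val then (p : ℚ) ^ 3 else (p : ℚ) ^ 2) =
      fun i => (p : ℚ) ^ HeckeDegree.exponent n i := by
    funext i
    unfold HeckeDegree.exponent
    split_ifs <;> simp
  rw [hfun, HeckeDegree.degree_diagonal (HeckeDegree.exponent_le n)
    (HeckeDegree.monotone_exponent n)]
  obtain ⟨m, rfl⟩ : ∃ m, n = 1 + (m + 2) := ⟨n - 3, by lia⟩
  have h := (HeckeDegree.parahoricSubgroup p 3
    (HeckeDegree.exponent (1 + (m + 2)))).card_mul_index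
  rw [HeckeDegree.card_parahoricSubgroup, HeckeDegree.card_parahoric_exponent,
    HeckeDegree.card_GL_zmod_pow three_ne_zero] at h
  generalize (HeckeDegree.parahoricSubgroup p 3
    (HeckeDegree.exponent (1 + (m + 2)))).index = d at h ⊢
  rw [show 1 + (m + 2) = m + 1 + 1 + 1 by ring] at h
  have h' := congrArg (Nat.cast : ℕ → ℚ) h
  have h0 : (Nat.card (GL (Fin 0) (ZMod p)) : ℚ) = 1 := by simp
  push_cast [HeckeDegree.card_GL_succ, h0] at h'
  have hp1 : (1 : ℚ) < p := by exact_mod_cast hp.one_lt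
  have hx0 : (p : ℚ) ≠ 0 := by positivity
  have hx1 : (p : ℚ) - 1 ≠ 0 := by linarith
  have hx2 : (p : ℚ) ^ 2 - 1 ≠ 0 := by nlinarith
  have hG : (Nat.card (GL (Fin m) (ZMod p)) : ℚ) ≠ 0 := Nat.cast_ne_zero.2 Nat.card_pos.ne'
  rw [eq_div_iff (by positivity)]
  have hx : (p : ℚ) ^ (2 * m ^ 2 + 14 * m + 17) * Nat.card (GL (Fin m) (ZMod p)) ≠ 0 := by
    positivity
  apply mul_left_cancel₀ hx
  rw [show 1 + (m + 2) - 2 = m + 1 by lia, show 1 + (m + 2) - 1 = m + 2 by lia]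
  linear_combination h'
end

section
/- Let n ≥ 4 be an integer and p a prime. The degree of the diagonal matrix diag(1, p², …, p², p⁴) (with n−2 middle entries equal to p²) equals p^{2n−1}·(p^{n−1}−1)·(p^n−1)/(p−1)². -/
open Matrix

open scoped MatrixGroups

theorem Subgroup.index_eq_ncard_range {G α : Type*} [Group G] (K : Subgroup G) (F : G → α)
    (hF : ∀ g h, F g = F h ↔ g⁻¹ * h ∈ K) : K.index = (Set.range F).ncard := by
  rw [Subgroup.index_eq_card, ← Nat.card_coe_set_eq]
  refine Nat.card_congr (Equiv.ofBijective
    (fun q : G ⧸ K => Quotient.liftOn' q (fun g => (⟨F g, g, rfl⟩ : Set.range F)) ?_) ⟨?_, ?_⟩)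
  · intro g h hgh
    exact Subtype.ext ((hF g h).2 (QuotientGroup.leftRel_apply.1 hgh))
  · rintro ⟨g⟩ ⟨h⟩ hgh
    exact QuotientGroup.eq.2 ((hF g h).1 (congrArg Subtype.val hgh))
  · rintro ⟨_, g, rfl⟩
    exact ⟨QuotientGroup.mk g, rfl⟩

theorem Subgroup.relIndex_eq_ncard_image {G α : Type*} [Group G] (K B : Subgroup G) (F : G → α)
    (hF : ∀ g ∈ B, ∀ h ∈ B, F g = F h ↔ g⁻¹ * h ∈ K) : K.relIndex B = (F '' B).ncard := by
  rw [Subgroup.relIndex, Subgroup.index_eq_ncard_range (K.subgroupOf B) (fun g : B => F g)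
    (fun g h => hF g g.2 h h.2), Set.image_eq_range]
  rfl

theorem exists_isUnit_of_dotProduct_eq_one {ι R : Type*} [Fintype ι] [CommRing R] [IsLocalRing R]
    {r c : ι → R} (h : r ⬝ᵥ c = 1) :
    ∃ i, IsUnit (r i) := by
  by_contra! hr
  have : r ⬝ᵥ c ∈ IsLocalRing.maximalIdeal R :=
    Ideal.sum_mem _ fun i _ => Ideal.mul_mem_right _ _ (hr i)
  rw [h] at this
  exact (IsLocalRing.mem_maximalIdeal _).1 this isUnit_one

section Reduction

variable {ι : Type*} [Fintype ι] [DecidableEq ι] (R : Type*) [CommRing R]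

/-- Entrywise reduction of an element of `GL ι ℤ` to a matrix over `R`. -/
def red : GL ι ℤ →* Matrix ι ι R :=
  (Units.coeHom _).comp (Matrix.GeneralLinearGroup.map (Int.castRingHom R))

variable {R}

theorem red_apply (g : GL ι ℤ) (i j : ι) : red R g i j = (g i j : R) := rfl

theorem red_mul_inv (g : GL ι ℤ) : red R g * red R g⁻¹ = 1 := by rw [← map_mul]; simp

theorem red_inv_mul (g : GL ι ℤ) : red R g⁻¹ * red R g = 1 := by rw [← map_mul]; simp

/-- The transpose of an element of `GL ι ℤ`. -/
def transposeGL (g : GL ι ℤ) : GL ι ℤ where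
  val := g.valᵀ
  inv := g.invᵀ
  val_inv := by rw [← Matrix.transpose_mul]; simp
  inv_val := by rw [← Matrix.transpose_mul]; simp

theorem red_transposeGL (g : GL ι ℤ) : red R (transposeGL g) = (red R g)ᵀ := rfl

/-- The matrix `1 + u vᵀ`, which is invertible when `v` is orthogonal to `u`. -/
def eichler (u v : ι → ℤ) (h : v ⬝ᵥ u = 0) : GL ι ℤ where
  val := 1 + vecMulVec u v
  inv := 1 - vecMulVec u v
  val_inv := by
    have : vecMulVec u v * vecMulVec u v = 0 := by simp [vecMulVec_mul_vecMulVec, h]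
    rw [add_mul, one_mul, mul_sub, mul_one, this]; abel
  inv_val := by
    have : vecMulVec u v * vecMulVec u v = 0 := by simp [vecMulVec_mul_vecMulVec, h]
    rw [sub_mul, one_mul, mul_add, mul_one, this]; abel

theorem red_eichler (u v : ι → ℤ) (h : v ⬝ᵥ u = 0) :
    red R (eichler u v h) = 1 + vecMulVec (fun i => (u i : R)) (fun i => (v i : R)) := by
  ext i j
  rw [red_apply]
  simp [eichler, vecMulVec_apply, Matrix.one_apply]

/-- `c'` is the image of `c` under some `g ∈ GL ι ℤ` whose rows outside `s` are standard. -/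
def Reach (s : Set ι) (c c' : ι → R) : Prop :=
  ∃ g : GL ι ℤ, red R g *ᵥ c = c' ∧ ∀ i ∉ s, Pi.single i 1 ᵥ* red R g = Pi.single i 1

theorem Reach.trans {s : Set ι} {c c' c'' : ι → R} (h : Reach s c c') (h' : Reach s c' c'') :
    Reach s c c'' := by
  obtain ⟨g, rfl, hs⟩ := h
  obtain ⟨g', rfl, hs'⟩ := h'
  refine ⟨g' * g, by rw [map_mul, Matrix.mulVec_mulVec], fun i hi => ?_⟩
  rw [map_mul, ← Matrix.vecMul_vecMul, hs' i hi, hs i hi]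

theorem reach_eichler {s : Set ι} (c : ι → R) (u v : ι → ℤ) (h : v ⬝ᵥ u = 0)
    (hu : ∀ i ∉ s, u i = 0) :
    Reach s c (c + ((fun i => (v i : R)) ⬝ᵥ c) • (fun i => (u i : R))) := by
  refine ⟨eichler u v h, ?_, fun i hi => ?_⟩
  · rw [red_eichler, Matrix.add_mulVec, Matrix.one_mulVec, Matrix.vecMulVec_mulVec]
    ext; simp [mul_comm]
  · rw [red_eichler, Matrix.vecMul_add, Matrix.vecMul_one, Matrix.vecMul_vecMulVec]
    simp [hu i hi]

/-- Adding an arbitrary multiple of one coordinate to another one. -/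
theorem reach_add_single (hR : Function.Surjective (Int.cast : ℤ → R)) {s : Set ι} (c : ι → R)
    {i j : ι} (hij : i ≠ j) (hi : i ∈ s) (x : R) :
    Reach s c (c + Pi.single i (x * c j)) := by
  obtain ⟨z, rfl⟩ := hR x
  have := reach_eichler (s := s) c (Pi.single i 1) (Pi.single j z) (by simp [hij])
    (fun k hk => Pi.single_eq_of_ne (fun h : k = i => hk (h.symm ▸ hi)) _)
  convert this using 1
  have h1 : (fun k => ((Pi.single i 1 : ι → ℤ) k : R)) = Pi.single i 1 := by
    ext k; by_cases h : k = i <;> simp [h]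
  have h2 : (fun k => ((Pi.single j z : ι → ℤ) k : R)) = Pi.single j (z : R) := by
    ext k; by_cases h : k = j <;> simp [h]
  rw [h1, h2, single_dotProduct]
  ext k; by_cases h : k = i <;> simp [h]

theorem reach_single_of_eq_one (hR : Function.Surjective (Int.cast : ℤ → R)) {s : Set ι}
    (c : ι → R) (hc : ∀ i ∉ s, c i = 0) {k : ι} (hk : c k = 1) :
    Reach s c (Pi.single k 1) := by
  choose z hz using fun i => hR (c i)
  classical
  have := reach_eichler (s := s) c (fun i => if i = k ∨ i ∉ s then 0 else -z i) (Pi.single k 1)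
    (by simp) (fun i hi => by simp [hi])
  convert this using 1
  have h2 : (fun i => ((Pi.single k 1 : ι → ℤ) i : R)) = Pi.single k 1 := by
    ext i; by_cases h : i = k <;> simp [h]
  rw [h2, single_dotProduct, hk]
  ext i
  by_cases h : i = k
  · subst h; simp [hk]
  · by_cases hi : i ∈ s
    · simp [h, hi, hz]
    · simp [h, hi, hc]

theorem reach_single [IsLocalRing R] (hR : Function.Surjective (Int.cast : ℤ → R)) {s : Set ι}
    (c : ι → R) (hc : ∀ i ∉ s, c i = 0) (hu : ∃ i, IsUnit (c i)) {k l : ι} (hk : k ∈ s)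
    (hl : l ∈ s) (hkl : l ≠ k) : Reach s c (Pi.single k 1) := by
  have main : ∀ c : ι → R, (∀ i ∉ s, c i = 0) → ∀ i ∈ s, i ≠ k → IsUnit (c i) →
      Reach s c (Pi.single k 1) := by
    intro c hc i _ hik hi
    refine (reach_add_single hR c hik.symm hk ((1 - c k) * ↑hi.unit⁻¹)).trans
      (reach_single_of_eq_one hR _ (fun j hj => ?_) ?_)
    · have : j ≠ k := fun h => hj (h ▸ hk)
      simp [hc j hj, this]
    · simp [mul_assoc]
  obtain ⟨i, hi⟩ := hu
  have his : i ∈ s := by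
    by_contra h
    rw [hc i h] at hi
    exact not_isUnit_zero hi
  by_cases hik : i = k
  · subst hik
    by_cases hlu : IsUnit (c l)
    · exact main c hc l hl hkl hlu
    · refine (reach_add_single hR c hkl hl 1).trans (main _ (fun j hj => ?_) l hl hkl ?_)
      · have : j ≠ l := fun h => hj (h ▸ hl)
        simp [hc j hj, this]
      · by_contra h
        have := IsLocalRing.nonunits_add (a := (c + (Pi.single l (1 * c i) : ι → R)) l) (b := -c l) h
          (by simpa using hlu)
        simp at this
        exact this hi
  · exact main c hc i his hik hi

/-- `GL ι ℤ` acts transitively on the pairs consisting of a unimodular row and a unimodular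
column orthogonal to it. -/
theorem exists_red_eq [IsLocalRing R] (hR : Function.Surjective (Int.cast : ℤ → R)) {a b d : ι}
    (hab : a ≠ b) (had : d ≠ a) (hbd : d ≠ b) {r c : ι → R} (hr : ∃ i, IsUnit (r i))
    (hc : ∃ i, IsUnit (c i)) (hrc : r ⬝ᵥ c = 0) :
    ∃ g : GL ι ℤ, Pi.single a 1 ᵥ* red R g⁻¹ = r ∧ red R g *ᵥ Pi.single b 1 = c := by
  obtain ⟨g, hg, -⟩ := reach_single hR (s := Set.univ) c (by simp) hc (k := b) (l := a) trivial
    trivial hab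
  have hr' : ∃ i, IsUnit ((r ᵥ* red R g⁻¹) i) := by
    obtain ⟨i, hi⟩ := hr
    refine exists_isUnit_of_dotProduct_eq_one (c := red R g *ᵥ Pi.single i (↑hi.unit⁻¹ : R)) ?_
    rw [← Matrix.dotProduct_mulVec, Matrix.mulVec_mulVec, red_inv_mul,
      Matrix.one_mulVec, dotProduct_single]
    simp
  have hrb : (r ᵥ* red R g⁻¹) b = 0 := by
    have : (r ᵥ* red R g⁻¹) ⬝ᵥ Pi.single b 1 = 0 := by
      rw [← hg, ← Matrix.dotProduct_mulVec, Matrix.mulVec_mulVec, red_inv_mul]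
      simpa using hrc
    simpa using this
  obtain ⟨h, hh, hb⟩ := reach_single hR (s := {b}ᶜ) (r ᵥ* red R g⁻¹) (by simpa using hrb) hr'
    (k := a) (l := d) (by simpa using hab) (by simpa using hbd) had
  have hb := hb b (by simp)
  rw [← Matrix.vecMul_transpose, ← red_transposeGL] at hh
  rw [← Matrix.mulVec_transpose, ← red_transposeGL] at hb
  refine ⟨g⁻¹ * transposeGL h, ?_, ?_⟩
  · rw [_root_.mul_inv_rev, inv_inv, map_mul, ← hh, Matrix.vecMul_vecMul, ← mul_assoc,
      red_mul_inv, one_mul, Matrix.vecMul_vecMul, red_inv_mul, Matrix.vecMul_one]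
  · rw [map_mul, ← Matrix.mulVec_mulVec, hb, ← hg, Matrix.mulVec_mulVec, red_inv_mul,
      Matrix.one_mulVec]

end Reduction
theorem Set.ncard_setOf_forall_mem {ι α : Type*} [Fintype ι] (s : ι → Set α) :
    {f : ι → α | ∀ i, f i ∈ s i}.ncard = ∏ i, (s i).ncard := by
  rw [← Nat.card_coe_set_eq]
  refine (Nat.card_congr (Equiv.subtypePiEquivPi (p := fun i x => x ∈ s i))).trans ?_
  rw [Nat.card_pi]
  rfl

theorem Finset.prod_ite_eq_else_const {ι : Type*} [Fintype ι] [DecidableEq ι] (b : ι) (y z : ℕ) :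
    ∏ i, (if i = b then y else z) = y * z ^ (Fintype.card ι - 1) := by
  simp [Finset.prod_ite, Finset.filter_eq', Finset.filter_ne', Finset.card_erase_of_mem]

theorem Finset.prod_ite_eq_ite_eq_else_const {ι : Type*} [Fintype ι] [DecidableEq ι] {a b : ι}
    (hab : a ≠ b) (x y z : ℕ) :
    ∏ i, (if i = a then x else if i = b then y else z) = x * y * z ^ (Fintype.card ι - 2) := by
  rw [← Finset.mul_prod_erase _ _ (Finset.mem_univ a),
    ← Finset.mul_prod_erase _ _ (Finset.mem_erase.2 ⟨hab.symm, Finset.mem_univ b⟩), if_pos rfl,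
    if_neg hab.symm, if_pos rfl, mul_assoc, Finset.prod_congr rfl (g := fun _ => z)]
  · simp [Finset.card_erase_of_mem, hab.symm, Nat.sub_sub]
  · intro i hi
    simp only [Finset.mem_erase] at hi
    simp [hi.1, hi.2.1]

section PrimePower

variable {p : ℕ} [hp : Fact p.Prime]

theorem zmod_pow_mul_eq_zero_iff {k m : ℕ} (hk : k ≤ m) (z : ℤ) :
    (p : ZMod (p ^ m)) ^ k * z = 0 ↔ (p : ℤ) ^ (m - k) ∣ z := by
  have h : (p : ZMod (p ^ m)) ^ k * z = (((p : ℤ) ^ k * z : ℤ) : ZMod (p ^ m)) := by push_cast; rfl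
  rw [h, ZMod.intCast_zmod_eq_zero_iff_dvd]
  push_cast
  conv_lhs => rw [← Nat.add_sub_cancel' hk, pow_add]
  exact mul_dvd_mul_iff_left (pow_ne_zero _ (by exact_mod_cast hp.1.ne_zero))

theorem zmod_isUnit_intCast_iff {m : ℕ} (hm : 0 < m) (z : ℤ) :
    IsUnit (z : ZMod (p ^ m)) ↔ ¬ (p : ℤ) ∣ z := by
  obtain ⟨a, ha | ha⟩ := z.eq_nat_or_neg <;> subst ha
  · simpa [Int.natCast_dvd_natCast] using ZMod.isUnit_natCast_iff_not_dvd_pow hp.1 hm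
  · simpa [Int.natCast_dvd_natCast] using ZMod.isUnit_natCast_iff_not_dvd_pow hp.1 hm

theorem zmod_not_isUnit_iff (x : ZMod (p ^ 4)) : ¬ IsUnit x ↔ (p : ZMod (p ^ 4)) ^ 3 * x = 0 := by
  obtain ⟨z, rfl⟩ := ZMod.intCast_surjective x
  rw [zmod_isUnit_intCast_iff (by norm_num), zmod_pow_mul_eq_zero_iff (by norm_num)]
  simp

theorem zmod_mul_eq_zero {x y : ZMod (p ^ 4)} (hx : (p : ZMod (p ^ 4)) ^ 2 * x = 0)
    (hy : (p : ZMod (p ^ 4)) ^ 2 * y = 0) : x * y = 0 := by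
  obtain ⟨x, rfl⟩ := ZMod.intCast_surjective x
  obtain ⟨y, rfl⟩ := ZMod.intCast_surjective y
  rw [zmod_pow_mul_eq_zero_iff (by norm_num)] at hx hy
  rw [← Int.cast_mul, ZMod.intCast_zmod_eq_zero_iff_dvd]
  have := mul_dvd_mul hx hy
  rw [← pow_add] at this
  exact_mod_cast this

theorem zmod_pow_three_ne_zero : (p : ZMod (p ^ 4)) ^ 3 ≠ 0 := by
  have := (zmod_not_isUnit_iff (1 : ZMod (p ^ 4))).not_right.1 isUnit_one
  simpa using this

instance : Nontrivial (ZMod (p ^ 4)) := ⟨_, _, zmod_pow_three_ne_zero⟩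

instance : IsLocalRing (ZMod (p ^ 4)) :=
  IsLocalRing.of_nonunits_add fun x y hx hy => by
    rw [mem_nonunits_iff, zmod_not_isUnit_iff] at *
    rw [mul_add, hx, hy, add_zero]

theorem ncard_zmod_pow_mul_eq_zero {k m : ℕ} (hk : k ≤ m) :
    {x : ZMod (p ^ m) | (p : ZMod (p ^ m)) ^ k * x = 0}.ncard = p ^ k := by
  have := IsAddCyclic.card_nsmulAddMonoidHom_ker (G := ZMod (p ^ m)) (p ^ k)
  rw [Nat.card_zmod, Nat.gcd_eq_right (pow_dvd_pow p hk)] at this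
  rw [← this, ← Nat.card_coe_set_eq]
  refine Nat.card_congr (Equiv.subtypeEquivRight fun x => ?_)
  simp [AddMonoidHom.mem_ker]

theorem ncard_zmod_not_isUnit : {x : ZMod (p ^ 4) | ¬ IsUnit x}.ncard = p ^ 3 := by
  simp_rw [zmod_not_isUnit_iff]
  exact ncard_zmod_pow_mul_eq_zero (by norm_num)

theorem ncard_zmod_isUnit : {x : ZMod (p ^ 4) | IsUnit x}.ncard = p ^ 4 - p ^ 3 := by
  have := Set.ncard_add_ncard_compl {x : ZMod (p ^ 4) | IsUnit x}
  rw [Nat.card_zmod, Set.compl_ofPred, ncard_zmod_not_isUnit] at this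
  omega

variable {ι : Type*} [Fintype ι]

variable (p ι) in
theorem ncard_unimodular :
    {c : ι → ZMod (p ^ 4) | ∃ i, IsUnit (c i)}.ncard =
      p ^ (4 * Fintype.card ι) - p ^ (3 * Fintype.card ι) := by
  have := Set.ncard_add_ncard_compl {c : ι → ZMod (p ^ 4) | ∃ i, IsUnit (c i)}
  have h : {c : ι → ZMod (p ^ 4) | ∃ i, IsUnit (c i)}ᶜ =
      {c | ∀ i, c i ∈ {x : ZMod (p ^ 4) | ¬ IsUnit x}} := by ext; simp
  rw [h, Set.ncard_setOf_forall_mem, ncard_zmod_not_isUnit, Nat.card_pi] at this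
  simp only [Nat.card_zmod, Finset.prod_const, Finset.card_univ, ← pow_mul] at this
  omega

variable [DecidableEq ι]

variable (p) in
theorem ncard_unimodular_of_eq_zero (b : ι) :
    {r : ι → ZMod (p ^ 4) | (∃ i, IsUnit (r i)) ∧ r b = 0}.ncard =
      p ^ (4 * (Fintype.card ι - 1)) - p ^ (3 * (Fintype.card ι - 1)) := by
  have key : ∀ s : Set (ZMod (p ^ 4)),
      {r : ι → ZMod (p ^ 4) | ∀ i, r i ∈ if i = b then {0} else s}.ncard =
        s.ncard ^ (Fintype.card ι - 1) := fun s => by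
    rw [Set.ncard_setOf_forall_mem, ← one_mul (s.ncard ^ _), ← Finset.prod_ite_eq_else_const b]
    refine Finset.prod_congr rfl fun i _ => ?_
    split_ifs <;> simp
  have h : {r : ι → ZMod (p ^ 4) | (∃ i, IsUnit (r i)) ∧ r b = 0} =
      {r | ∀ i, r i ∈ if i = b then {0} else Set.univ} \
        {r | ∀ i, r i ∈ if i = b then {0} else {x : ZMod (p ^ 4) | ¬ IsUnit x}} := by
    ext r
    simp only [Set.mem_ofPred_eq, Set.mem_sdiff]
    constructor
    · rintro ⟨⟨i, hi⟩, hb⟩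
      refine ⟨fun j => ?_, fun h => ?_⟩
      · split_ifs with hj <;> simp [hj, hb]
      · have hib : i ≠ b := by rintro rfl; simp [hb] at hi
        have := h i
        rw [if_neg hib] at this
        exact this hi
    · rintro ⟨h1, h2⟩
      have hb : r b = 0 := by simpa using h1 b
      refine ⟨?_, hb⟩
      by_contra! hr
      refine h2 fun j => ?_
      split_ifs with hj
      · simp [hj, hb]
      · exact hr j
  rw [h, Set.ncard_sdiff, key, key, ncard_zmod_not_isUnit, Set.ncard_univ, Nat.card_zmod,
    ← pow_mul, ← pow_mul]
  intro r hr i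
  have := hr i
  split_ifs at * with hi <;> simp_all

/-- The vectors with a unit at `a`, zero at `b`, and multiples of `p ^ 2` elsewhere. -/
def congruenceVectors (p : ℕ) (a b : ι) : Set (ι → ZMod (p ^ 4)) :=
  {r | IsUnit (r a) ∧ r b = 0 ∧ ∀ i, i ≠ a → (p : ZMod (p ^ 4)) ^ 2 * r i = 0}

theorem ncard_congruenceVectors {a b : ι} (hab : a ≠ b) :
    (congruenceVectors p a b).ncard = (p ^ 4 - p ^ 3) * (p ^ 2) ^ (Fintype.card ι - 2) := by
  have h : congruenceVectors p a b =
      {r | ∀ i, r i ∈ if i = a then {x : ZMod (p ^ 4) | IsUnit x} else if i = b then {0} else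
        {x : ZMod (p ^ 4) | (p : ZMod (p ^ 4)) ^ 2 * x = 0}} := by
    ext r
    constructor
    · rintro ⟨ha, hb, h⟩ i
      split_ifs with h1 h2
      · exact h1 ▸ ha
      · exact h2 ▸ hb
      · exact h i h1
    · intro h
      have hb : r b = 0 := by simpa [hab.symm] using h b
      refine ⟨by simpa using h a, hb, fun i hi => ?_⟩
      by_cases hib : i = b
      · rw [hib, hb, mul_zero]
      · simpa [hi, hib] using h i
  rw [h, Set.ncard_setOf_forall_mem, ← mul_one (p ^ 4 - p ^ 3),
    ← Finset.prod_ite_eq_ite_eq_else_const hab]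
  refine Finset.prod_congr rfl fun i _ => ?_
  split_ifs
  · exact ncard_zmod_isUnit
  · simp
  · exact ncard_zmod_pow_mul_eq_zero (by norm_num)

end PrimePower
section Subgroups

variable {ι : Type*} [Fintype ι] [DecidableEq ι]

/-- The elements of `GL ι ℤ` whose column `b` is standard over `R`. -/
def colStab (R : Type*) [CommRing R] (b : ι) : Subgroup (GL ι ℤ) where
  carrier := {g | red R g *ᵥ Pi.single b 1 = Pi.single b 1}
  one_mem' := by
    change red R 1 *ᵥ _ = _
    rw [map_one, Matrix.one_mulVec]
  mul_mem' {g h} hg hh := by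
    change red R (g * h) *ᵥ _ = _
    rw [map_mul, ← Matrix.mulVec_mulVec, hh, hg]
  inv_mem' {g} hg := by
    change red R g⁻¹ *ᵥ _ = _
    conv_lhs => rw [← show red R g *ᵥ Pi.single b 1 = Pi.single b 1 from hg]
    rw [Matrix.mulVec_mulVec, red_inv_mul, Matrix.one_mulVec]

/-- The elements of `GL ι ℤ` whose row `a` is standard over `R`. -/
def rowStab (R : Type*) [CommRing R] (a : ι) : Subgroup (GL ι ℤ) where
  carrier := {g | Pi.single a 1 ᵥ* red R g = Pi.single a 1}
  one_mem' := by
    change _ ᵥ* red R 1 = _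
    rw [map_one, Matrix.vecMul_one]
  mul_mem' {g h} hg hh := by
    change _ ᵥ* red R (g * h) = _
    rw [map_mul, ← Matrix.vecMul_vecMul, hg, hh]
  inv_mem' {g} hg := by
    change _ ᵥ* red R g⁻¹ = _
    conv_lhs => rw [← show Pi.single a 1 ᵥ* red R g = Pi.single a 1 from hg]
    rw [Matrix.vecMul_vecMul, red_mul_inv, Matrix.vecMul_one]

/-- The elements `g` of `GL ι ℤ` such that `diag(d) g diag(d)⁻¹` is again in `GL ι ℤ`. -/
def diagonalSubgroup (d : ι → ℤ) : Subgroup (GL ι ℤ) where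
  carrier := {g | ∃ k : GL ι ℤ, diagonal d * g.val = k.val * diagonal d}
  one_mem' := ⟨1, by simp⟩
  mul_mem' := by
    rintro g h ⟨k, hk⟩ ⟨l, hl⟩
    refine ⟨k * l, ?_⟩
    rw [Units.val_mul, Units.val_mul, ← mul_assoc, hk, mul_assoc, hl, mul_assoc]
  inv_mem' := by
    rintro g ⟨k, hk⟩
    refine ⟨k⁻¹, ?_⟩
    rw [Units.eq_inv_mul_iff_mul_eq, ← mul_assoc, ← hk, mul_assoc, ← Units.val_mul]
    simp

theorem mem_colStab {R : Type*} [CommRing R] {b : ι} {g : GL ι ℤ} :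
    g ∈ colStab R b ↔ red R g *ᵥ Pi.single b 1 = Pi.single b 1 := Iff.rfl

theorem mem_rowStab {R : Type*} [CommRing R] {a : ι} {g : GL ι ℤ} :
    g ∈ rowStab R a ↔ Pi.single a 1 ᵥ* red R g = Pi.single a 1 := Iff.rfl

theorem mem_diagonalSubgroup {d : ι → ℤ} {g : GL ι ℤ} :
    g ∈ diagonalSubgroup d ↔ ∃ k : GL ι ℤ, diagonal d * g.val = k.val * diagonal d := Iff.rfl

theorem mem_diagonalSubgroup_iff_dvd {d : ι → ℤ} (hd : ∀ i, d i ≠ 0) {g : GL ι ℤ} :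
    g ∈ diagonalSubgroup d ↔ ∀ i j, d j ∣ d i * g i j := by
  rw [mem_diagonalSubgroup]
  constructor
  · rintro ⟨k, hk⟩ i j
    have := congrFun (congrFun hk i) j
    rw [Matrix.diagonal_mul, Matrix.mul_diagonal] at this
    exact this ▸ dvd_mul_left _ _
  · intro h
    choose k hk using h
    have hm : diagonal d * g.val = Matrix.of k * diagonal d := by
      ext i j
      rw [Matrix.diagonal_mul, Matrix.mul_diagonal, Matrix.of_apply, hk, mul_comm]
    have hdet : (Matrix.of k).det = g.val.det := by
      have := congrArg Matrix.det hm
      rw [Matrix.det_mul, Matrix.det_mul, mul_comm, Matrix.det_diagonal] at this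
      exact (mul_right_cancel₀ (Finset.prod_ne_zero_iff.2 fun i _ => hd i) this).symm
    refine ⟨Matrix.GeneralLinearGroup.mk'' (Matrix.of k) ?_, hm⟩
    rw [hdet]
    exact (Matrix.isUnit_iff_isUnit_det _).1 g.isUnit

variable {R : Type*} [CommRing R]

theorem red_mulVec_eq_iff {b : ι} {g h : GL ι ℤ} :
    red R g *ᵥ Pi.single b 1 = red R h *ᵥ Pi.single b 1 ↔ g⁻¹ * h ∈ colStab R b := by
  rw [mem_colStab, map_mul, ← Matrix.mulVec_mulVec]
  constructor
  · intro e
    rw [← e, Matrix.mulVec_mulVec, red_inv_mul, Matrix.one_mulVec]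
  · intro e
    conv_lhs => rw [← e]
    rw [Matrix.mulVec_mulVec, red_mul_inv, Matrix.one_mulVec]

theorem vecMul_red_inv_eq_iff {a : ι} {g h : GL ι ℤ} :
    Pi.single a 1 ᵥ* red R g⁻¹ = Pi.single a 1 ᵥ* red R h⁻¹ ↔ g⁻¹ * h ∈ rowStab R a := by
  rw [mem_rowStab, map_mul, ← Matrix.vecMul_vecMul]
  constructor
  · intro e
    rw [e, Matrix.vecMul_vecMul, red_inv_mul, Matrix.vecMul_one]
  · intro e
    conv_rhs => rw [← e]
    rw [Matrix.vecMul_vecMul, red_mul_inv, Matrix.vecMul_one]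

theorem exists_isUnit_vecMul_red [IsLocalRing R] (a : ι) (g : GL ι ℤ) :
    ∃ i, IsUnit ((Pi.single a 1 ᵥ* red R g) i) := by
  refine exists_isUnit_of_dotProduct_eq_one (c := red R g⁻¹ *ᵥ Pi.single a 1) ?_
  rw [← Matrix.dotProduct_mulVec, Matrix.mulVec_mulVec, red_mul_inv, Matrix.one_mulVec]
  simp

theorem exists_isUnit_red_mulVec [IsLocalRing R] (b : ι) (g : GL ι ℤ) :
    ∃ i, IsUnit ((red R g *ᵥ Pi.single b 1) i) := by
  refine exists_isUnit_of_dotProduct_eq_one (c := Pi.single b 1 ᵥ* red R g⁻¹) ?_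
  rw [dotProduct_comm, ← Matrix.dotProduct_mulVec, Matrix.mulVec_mulVec, red_inv_mul,
    Matrix.one_mulVec]
  simp

end Subgroups

/-- The diagonal entries `1, p ^ 2, …, p ^ 2, p ^ 4`, with `1` at `a` and `p ^ 4` at `b`. -/
def heckeDiagonal {ι : Type*} [DecidableEq ι] (p : ℕ) (a b i : ι) : ℤ :=
  if i = a then 1 else if i = b then (p : ℤ) ^ 4 else (p : ℤ) ^ 2

theorem heckeDiagonal_ne_zero {ι : Type*} [DecidableEq ι] {p : ℕ} [hp : Fact p.Prime] (a b i : ι) : heckeDiagonal p a b i ≠ 0 := by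
  have : (p : ℤ) ≠ 0 := by exact_mod_cast hp.1.ne_zero
  unfold heckeDiagonal
  split_ifs <;> positivity

section Index

variable {ι : Type*} [Fintype ι] [DecidableEq ι] {p : ℕ} [hp : Fact p.Prime] {a b d : ι}

theorem index_colStab (hab : a ≠ b) :
    (colStab (ZMod (p ^ 4)) b).index =
      p ^ (4 * Fintype.card ι) - p ^ (3 * Fintype.card ι) := by
  rw [← ncard_unimodular p ι, Subgroup.index_eq_ncard_range _
    (fun g => red (ZMod (p ^ 4)) g *ᵥ Pi.single b 1) (fun g h => red_mulVec_eq_iff)]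
  congr 1
  ext c
  constructor
  · rintro ⟨g, rfl⟩
    exact exists_isUnit_red_mulVec b g
  · intro hc
    obtain ⟨g, hg, -⟩ := reach_single ZMod.intCast_surjective (s := Set.univ) c (by simp) hc
      (k := b) (l := a) trivial trivial hab
    refine ⟨g⁻¹, ?_⟩
    dsimp only
    rw [← hg, Matrix.mulVec_mulVec, red_inv_mul, Matrix.one_mulVec]

theorem relIndex_rowStab_colStab (hab : a ≠ b) (had : d ≠ a) (hbd : d ≠ b) :
    (rowStab (ZMod (p ^ 4)) a).relIndex (colStab (ZMod (p ^ 4)) b) =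
      p ^ (4 * (Fintype.card ι - 1)) - p ^ (3 * (Fintype.card ι - 1)) := by
  rw [← ncard_unimodular_of_eq_zero p b, Subgroup.relIndex_eq_ncard_image _ _
    (fun g => Pi.single a 1 ᵥ* red (ZMod (p ^ 4)) g⁻¹)
    (fun g _ h _ => vecMul_red_inv_eq_iff)]
  congr 1
  ext r
  constructor
  · rintro ⟨g, hg, rfl⟩
    refine ⟨exists_isUnit_vecMul_red a g⁻¹, ?_⟩
    have : (Pi.single a 1 ᵥ* red (ZMod (p ^ 4)) g⁻¹) ⬝ᵥ Pi.single b 1 = 0 := by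
      rw [← Matrix.dotProduct_mulVec, mem_colStab.1 (inv_mem hg)]
      simp [hab]
    simpa using this
  · rintro ⟨hr, hrb⟩
    obtain ⟨g, h1, h2⟩ := exists_red_eq ZMod.intCast_surjective hab had hbd hr
      (c := Pi.single b 1) ⟨b, by simp⟩ (by simpa using hrb)
    exact ⟨g, h2, h1⟩

theorem mem_diagonalSubgroup_heckeDiagonal (hab : a ≠ b) {g : GL ι ℤ} :
    g ∈ diagonalSubgroup (heckeDiagonal p a b) ↔ red (ZMod (p ^ 4)) g a b = 0 ∧
      (∀ j, j ≠ a → (p : ZMod (p ^ 4)) ^ 2 * red (ZMod (p ^ 4)) g a j = 0) ∧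
      ∀ i, i ≠ b → (p : ZMod (p ^ 4)) ^ 2 * red (ZMod (p ^ 4)) g i b = 0 := by
  have hp0 : (p : ℤ) ^ 2 ≠ 0 := pow_ne_zero _ (by exact_mod_cast hp.1.ne_zero)
  have h24 : (p : ℤ) ^ 2 ∣ (p : ℤ) ^ 4 := pow_dvd_pow _ (by norm_num)
  have h4 : (p : ℤ) ^ 4 = (p : ℤ) ^ 2 * (p : ℤ) ^ 2 := by ring
  simp only [red_apply, zmod_pow_mul_eq_zero_iff (show 2 ≤ 4 by norm_num),
    ZMod.intCast_zmod_eq_zero_iff_dvd]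
  rw [mem_diagonalSubgroup_iff_dvd (heckeDiagonal_ne_zero a b)]
  push_cast
  constructor
  · intro h
    have hgab : (p : ℤ) ^ 4 ∣ g a b := by simpa [heckeDiagonal, hab.symm] using h a b
    refine ⟨hgab, fun j hj => ?_, fun i hi => ?_⟩
    · by_cases hjb : j = b
      · exact hjb ▸ h24.trans hgab
      · simpa [heckeDiagonal, hj, hjb] using h a j
    · by_cases hia : i = a
      · exact hia ▸ h24.trans hgab
      · have := h i b
        simp only [heckeDiagonal, hab.symm, hi, hia, if_true, if_false] at this
        rw [h4] at this
        exact (mul_dvd_mul_iff_left hp0).1 this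
  · rintro ⟨h1, h2, h3⟩ i j
    unfold heckeDiagonal
    by_cases hja : j = a
    · simp [hja]
    · rw [if_neg hja]
      by_cases hia : i = a
      · subst hia
        rw [if_pos rfl, one_mul]
        split_ifs with hjb
        · exact hjb ▸ h1
        · exact h2 j hja
      · rw [if_neg hia]
        by_cases hib : i = b
        · rw [if_pos hib]
          split_ifs
          · exact dvd_mul_right _ _
          · exact h24.mul_right _
        · rw [if_neg hib]
          split_ifs with hjb
          · rw [h4, hjb]
            exact mul_dvd_mul_left _ (h3 i hib)
          · exact dvd_mul_right _ _

theorem isUnit_of_dotProduct_eq_one {r c : ι → ZMod (p ^ 4)} (h : r ⬝ᵥ c = 1)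
    (hr : ∀ i, i ≠ a → (p : ZMod (p ^ 4)) ^ 2 * r i = 0) : IsUnit (r a) := by
  by_contra ha
  rw [zmod_not_isUnit_iff] at ha
  refine zmod_pow_three_ne_zero (p := p) ?_
  rw [← mul_one (_ ^ 3), ← h, dotProduct, Finset.mul_sum]
  refine Finset.sum_eq_zero fun i _ => ?_
  by_cases hi : i = a
  · rw [hi, ← mul_assoc, ha, zero_mul]
  · linear_combination (p : ZMod (p ^ 4)) * c i * hr i hi

theorem vecMul_red_mem_congruenceVectors (hab : a ≠ b) {g : GL ι ℤ}
    (hg : g ∈ diagonalSubgroup (heckeDiagonal p a b)) :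
    Pi.single a 1 ᵥ* red (ZMod (p ^ 4)) g ∈ congruenceVectors p a b := by
  obtain ⟨h1, h2, -⟩ := (mem_diagonalSubgroup_heckeDiagonal hab).1 hg
  rw [Matrix.single_one_vecMul]
  refine ⟨isUnit_of_dotProduct_eq_one (c := fun j => red (ZMod (p ^ 4)) g⁻¹ j a) ?_ h2, h1, h2⟩
  have := congrFun (congrFun (red_mul_inv (R := ZMod (p ^ 4)) g) a) a
  rwa [Matrix.one_apply_eq, Matrix.mul_apply] at this

theorem red_mulVec_mem_congruenceVectors (hab : a ≠ b) {g : GL ι ℤ}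
    (hg : g ∈ diagonalSubgroup (heckeDiagonal p a b)) :
    red (ZMod (p ^ 4)) g *ᵥ Pi.single b 1 ∈ congruenceVectors p b a := by
  obtain ⟨h1, -, h3⟩ := (mem_diagonalSubgroup_heckeDiagonal hab).1 hg
  rw [Matrix.mulVec_single_one]
  refine ⟨isUnit_of_dotProduct_eq_one (c := fun j => red (ZMod (p ^ 4)) g⁻¹ b j) ?_ h3, h1, h3⟩
  have := congrFun (congrFun (red_inv_mul (R := ZMod (p ^ 4)) g) b) b
  rw [Matrix.one_apply_eq, Matrix.mul_apply] at this
  rw [dotProduct_comm]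
  exact this

theorem mem_diagonalSubgroup_of_mem_congruenceVectors (hab : a ≠ b) {g : GL ι ℤ}
    (hr : Pi.single a 1 ᵥ* red (ZMod (p ^ 4)) g⁻¹ ∈ congruenceVectors p a b)
    (hc : red (ZMod (p ^ 4)) g *ᵥ Pi.single b 1 ∈ congruenceVectors p b a) :
    g ∈ diagonalSubgroup (heckeDiagonal p a b) := by
  rw [Matrix.single_one_vecMul] at hr
  rw [Matrix.mulVec_single_one] at hc
  obtain ⟨ha, -, hr⟩ := hr
  obtain ⟨-, h1, h3⟩ := hc
  refine (mem_diagonalSubgroup_heckeDiagonal hab).2 ⟨h1, fun j hj => ?_, h3⟩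
  have := congrFun (congrFun (red_inv_mul (R := ZMod (p ^ 4)) g) a) j
  rw [Matrix.one_apply_ne hj.symm, Matrix.mul_apply] at this
  replace this := congrArg ((p : ZMod (p ^ 4)) ^ 2 * ·) this
  simp only [Finset.mul_sum, mul_zero] at this
  rw [Finset.sum_eq_single a] at this
  · rw [mul_left_comm] at this
    exact (ha.mul_right_eq_zero).1 this
  · intro i _ hi
    rw [← mul_assoc]
    exact mul_eq_zero_of_left (hr i hi) _
  · simp

theorem relIndex_diagonalSubgroup (hab : a ≠ b) (had : d ≠ a) (hbd : d ≠ b) :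
    (rowStab (ZMod (p ^ 4)) a ⊓ colStab (ZMod (p ^ 4)) b).relIndex
      (diagonalSubgroup (heckeDiagonal p a b)) =
      ((p ^ 4 - p ^ 3) * (p ^ 2) ^ (Fintype.card ι - 2)) ^ 2 := by
  have hcard : (congruenceVectors p a b ×ˢ congruenceVectors p b a).ncard =
      ((p ^ 4 - p ^ 3) * (p ^ 2) ^ (Fintype.card ι - 2)) ^ 2 := by
    rw [Set.ncard_prod, ncard_congruenceVectors hab, ncard_congruenceVectors hab.symm]
    exact (sq _).symm
  rw [← hcard, Subgroup.relIndex_eq_ncard_image _ _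
    (fun g => (Pi.single a 1 ᵥ* red (ZMod (p ^ 4)) g⁻¹, red (ZMod (p ^ 4)) g *ᵥ Pi.single b 1))
    (fun g _ h _ => by
      rw [Prod.mk.injEq, vecMul_red_inv_eq_iff, red_mulVec_eq_iff, Subgroup.mem_inf])]
  congr 1
  ext ⟨r, c⟩
  constructor
  · rintro ⟨g, hg, h⟩
    cases h
    exact ⟨vecMul_red_mem_congruenceVectors hab (inv_mem hg),
      red_mulVec_mem_congruenceVectors hab hg⟩
  · rintro ⟨hr : r ∈ _, hc : c ∈ _⟩
    have hrc : r ⬝ᵥ c = 0 := by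
      refine Finset.sum_eq_zero fun i _ => ?_
      by_cases hia : i = a
      · rw [hia, hc.2.1, mul_zero]
      · by_cases hib : i = b
        · rw [hib, hr.2.1, zero_mul]
        · exact zmod_mul_eq_zero (hr.2.2 i hia) (hc.2.2 i hib)
    obtain ⟨g, rfl, rfl⟩ := exists_red_eq ZMod.intCast_surjective hab had hbd ⟨a, hr.1⟩
      ⟨b, hc.1⟩ hrc
    exact ⟨g, mem_diagonalSubgroup_of_mem_congruenceVectors hab hr hc, rfl⟩

theorem rowStab_inf_colStab_le (hab : a ≠ b) :
    rowStab (ZMod (p ^ 4)) a ⊓ colStab (ZMod (p ^ 4)) b ≤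
      diagonalSubgroup (heckeDiagonal p a b) := by
  rintro g ⟨hr, hc⟩
  refine mem_diagonalSubgroup_of_mem_congruenceVectors hab ?_ ?_
  · rw [mem_rowStab.1 (inv_mem hr)]
    refine ⟨by simp, by simp [hab.symm], fun i hi => by simp [hi]⟩
  · rw [mem_colStab.1 hc]
    refine ⟨by simp, by simp [hab], fun i hi => by simp [hi]⟩

theorem index_diagonalSubgroup_mul (hab : a ≠ b) (had : d ≠ a) (hbd : d ≠ b) :
    ((p ^ 4 - p ^ 3) * (p ^ 2) ^ (Fintype.card ι - 2)) ^ 2 *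
      (diagonalSubgroup (heckeDiagonal p a b)).index =
    (p ^ (4 * (Fintype.card ι - 1)) - p ^ (3 * (Fintype.card ι - 1))) *
      (p ^ (4 * Fintype.card ι) - p ^ (3 * Fintype.card ι)) := by
  rw [← relIndex_diagonalSubgroup hab had hbd,
    Subgroup.relIndex_mul_index (rowStab_inf_colStab_le hab), ← index_colStab hab,
    ← relIndex_rowStab_colStab hab had hbd, ← Subgroup.inf_relIndex_right,
    Subgroup.relIndex_mul_index inf_le_right]

end Index

theorem mem_Lambda_iff {n : ℕ} {x : Matrix (Fin n) (Fin n) ℚ} :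
    x ∈ Lambda n ↔ ∃ g : GL (Fin n) ℤ, red ℚ g = x := by
  constructor
  · rintro ⟨hx, hdet⟩
    choose z hz using hx
    have hxz : (Matrix.of z).map (Int.castRingHom ℚ) = x := by ext i j; simp [hz]
    have hd : ((Matrix.of z).det : ℚ) = x.det := by
      rw [← hxz, ← RingHom.mapMatrix_apply, ← RingHom.map_det]
      rfl
    refine ⟨Matrix.GeneralLinearGroup.mk'' (Matrix.of z) ?_, hxz⟩
    rw [Int.isUnit_iff]
    rw [← hd] at hdet
    exact_mod_cast hdet
  · rintro ⟨g, rfl⟩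
    refine ⟨fun i j => ⟨g i j, rfl⟩, ?_⟩
    have hd : (red ℚ g).det = ((g.val.det : ℤ) : ℚ) :=
      (RingHom.map_det (Int.castRingHom ℚ) g.val).symm
    rw [hd]
    rcases Int.isUnit_iff.1 ((Matrix.isUnit_iff_isUnit_det _).1 g.isUnit) with h | h <;> simp [h]

theorem rightCoset_red_mul {n : ℕ} (g : GL (Fin n) ℤ) (h : Matrix (Fin n) (Fin n) ℚ) :
    rightCoset n (red ℚ g * h) = rightCoset n h := by
  ext x
  constructor
  · rintro ⟨_, hk, rfl⟩
    obtain ⟨k, rfl⟩ := mem_Lambda_iff.1 hk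
    exact ⟨_, mem_Lambda_iff.2 ⟨k * g, rfl⟩, by rw [map_mul, mul_assoc]⟩
  · rintro ⟨_, hk, rfl⟩
    obtain ⟨k, rfl⟩ := mem_Lambda_iff.1 hk
    refine ⟨_, mem_Lambda_iff.2 ⟨k * g⁻¹, rfl⟩, ?_⟩
    rw [map_mul, mul_assoc, ← mul_assoc (red ℚ g⁻¹), red_inv_mul, one_mul]

theorem rightCoset_eq_rightCoset_iff {n : ℕ} {x y : Matrix (Fin n) (Fin n) ℚ} :
    rightCoset n x = rightCoset n y ↔ ∃ k : GL (Fin n) ℤ, x = red ℚ k * y := by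
  constructor
  · intro h
    have : x ∈ rightCoset n y := h ▸ ⟨1, mem_Lambda_iff.2 ⟨1, map_one _⟩, (one_mul x).symm⟩
    obtain ⟨_, hk, hx⟩ := this
    obtain ⟨k, rfl⟩ := mem_Lambda_iff.1 hk
    exact ⟨k, hx⟩
  · rintro ⟨k, rfl⟩
    exact rightCoset_red_mul k y

/-- The degree of an integral diagonal matrix is the index of the associated subgroup. -/
theorem degree_diagonal {n : ℕ} (d : Fin n → ℤ) :
    degree n (diagonal fun i => (d i : ℚ)) = (diagonalSubgroup d).index := by
  set D : Matrix (Fin n) (Fin n) ℚ := diagonal fun i => (d i : ℚ)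
  rw [degree, Subgroup.index_eq_ncard_range _ (fun g => rightCoset n (D * red ℚ g⁻¹))]
  · congr 1
    ext S
    constructor
    · rintro ⟨_, ⟨_, h1, _, h2, rfl⟩, rfl⟩
      obtain ⟨g, rfl⟩ := mem_Lambda_iff.1 h1
      obtain ⟨k, rfl⟩ := mem_Lambda_iff.1 h2
      exact ⟨k⁻¹, by simp only [inv_inv]; rw [mul_assoc, rightCoset_red_mul]⟩
    · rintro ⟨g, rfl⟩
      exact ⟨_, ⟨1, mem_Lambda_iff.2 ⟨1, map_one _⟩, _, mem_Lambda_iff.2 ⟨g⁻¹, rfl⟩, rfl⟩,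
        by rw [one_mul]⟩
  · intro g h
    rw [rightCoset_eq_rightCoset_iff, mem_diagonalSubgroup]
    refine exists_congr fun k => ?_
    have hcast : Function.Injective
        (fun M : Matrix (Fin n) (Fin n) ℤ => M.map (Int.castRingHom ℚ)) :=
      Matrix.map_injective Int.cast_injective
    have hDmap : (diagonal d).map (Int.castRingHom ℚ) = D := by
      rw [Matrix.diagonal_map (map_zero _)]
      rfl
    rw [← hcast.eq_iff]
    simp only [Matrix.map_mul, hDmap]
    change _ ↔ D * red ℚ (g⁻¹ * h) = red ℚ k * D
    rw [map_mul, ← mul_assoc, ← mul_assoc]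
    constructor
    · intro e
      rw [e, mul_assoc, red_inv_mul, mul_one]
    · intro e
      rw [← e, mul_assoc _ _ (red ℚ h⁻¹), red_mul_inv, mul_one]

theorem statement6 (n p : ℕ) (hn : 4 ≤ n) (hp : p.Prime) :
    (degree n (Matrix.diagonal fun i : Fin n =>
      if i.val = 0 then (1 : ℚ) else if i.val = n - 1 then (p : ℚ) ^ 4 else (p : ℚ) ^ 2) : ℚ) =
      (p : ℚ) ^ (2 * n - 1) * ((p : ℚ) ^ (n - 1) - 1) * ((p : ℚ) ^ n - 1) / ((p : ℚ) - 1) ^ 2 := by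
  have : Fact p.Prime := ⟨hp⟩
  let a : Fin n := ⟨0, by omega⟩
  let b : Fin n := ⟨n - 1, by omega⟩
  let d : Fin n := ⟨1, by omega⟩
  have hab : a ≠ b := by simp only [a, b, ne_eq, Fin.mk.injEq]; omega
  have had : d ≠ a := by simp [a, d]
  have hbd : d ≠ b := by simp only [d, b, ne_eq, Fin.mk.injEq]; omega
  have hdiag : (fun i : Fin n =>
      if i.val = 0 then (1 : ℚ) else if i.val = n - 1 then (p : ℚ) ^ 4 else (p : ℚ) ^ 2) =
      fun i => (heckeDiagonal p a b i : ℚ) := by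
    ext i
    simp only [heckeDiagonal, Fin.ext_iff, a, b]
    split_ifs <;> simp
  rw [hdiag, degree_diagonal]
  have key := congrArg (Nat.cast : ℕ → ℚ) (index_diagonalSubgroup_mul (p := p) hab had hbd)
  have hle : ∀ m, p ^ (3 * m) ≤ p ^ (4 * m) := fun m =>
    Nat.pow_le_pow_right hp.pos (by omega)
  have hle1 : p ^ 3 ≤ p ^ 4 := by simpa using hle 1
  rw [Fintype.card_fin] at key
  push_cast [hle, hle1] at key
  have h0 : (p : ℚ) ≠ 0 := by exact_mod_cast hp.ne_zero
  have h1 : (p : ℚ) - 1 ≠ 0 := sub_ne_zero.2 (by exact_mod_cast hp.one_lt.ne')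
  obtain ⟨m, rfl⟩ : ∃ m, n = m + 2 := ⟨n - 2, by omega⟩
  rw [show m + 2 - 1 = m + 1 by omega, show m + 2 - 2 = m by omega] at key
  rw [show m + 2 - 1 = m + 1 by omega, show 2 * (m + 2) - 1 = 2 * m + 3 by omega,
    eq_div_iff (pow_ne_zero 2 h1)]
  have h2 : (p : ℚ) ^ (4 * m + 6) ≠ 0 := pow_ne_zero _ h0
  refine mul_left_cancel₀ h2 ?_
  linear_combination key
end

section
/- Let n ≥ 4 be an integer and p a prime. The degree of the diagonal matrix diag(p, p, p², …, p², p⁴) (with n−3 entries equal to p²) equals p^{n+1}·(p^{n−2}−1)·(p^{n−1}−1)·(p^n−1)/((p−1)²·(p²−1)). -/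
open Matrix

theorem AddMonoidHom.surjective_of_mod_nsmul {A B : Type*} [AddCommGroup A] [AddCommGroup B]
    (f : A →+ B) (p k : ℕ) (hB : ∀ b : B, p ^ k • b = 0)
    (h : ∀ b : B, ∃ a : A, ∃ c : B, b = f a + p • c) : Function.Surjective f := by
  have key : ∀ (j : ℕ) (b : B), ∃ a c, b = f a + p ^ j • c := by
    intro j
    induction j with
    | zero => exact fun b => ⟨0, b, by simp⟩
    | succ j ih =>
      intro b
      obtain ⟨a, c, rfl⟩ := ih b
      obtain ⟨a', c', rfl⟩ := h c
      exact ⟨a + p ^ j • a', c', by simp [pow_succ, mul_smul, add_assoc]⟩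
  intro b
  obtain ⟨a, c, rfl⟩ := key k b
  exact ⟨a, by rw [hB, add_zero]⟩

theorem AddMonoidHom.comp_surjective_iff_of_nsmul {A B C : Type*} [AddCommGroup A]
    [AddCommGroup B] [AddCommGroup C] (f : A →+ B) (g : B →+ C) (p k : ℕ)
    (hB : ∀ b : B, p ^ k • b = 0) (hg : Function.Surjective g)
    (hker : ∀ b : B, g b = 0 → ∃ c, b = p • c) :
    Function.Surjective (g.comp f) ↔ Function.Surjective f := by
  refine ⟨fun h => f.surjective_of_mod_nsmul p k hB fun b => ?_, fun h => hg.comp h⟩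
  obtain ⟨a, ha⟩ := h (g b)
  obtain ⟨c, hc⟩ := hker (b - f a) (by simpa [sub_eq_zero] using ha.symm)
  exact ⟨a, c, by rw [← hc]; abel⟩

theorem AddMonoidHom.card_subtype_comp_mul_card {A B : Type*} [AddCommGroup A] [AddCommGroup B]
    [Finite A] [Finite B] (g : A →+ B) (hg : Function.Surjective g) (P : B → Prop) :
    Nat.card {a // P (g a)} * Nat.card B = Nat.card A * Nat.card {b // P b} := by
  classical
  obtain ⟨s, hs⟩ := hg.hasRightInverse
  have e : ∀ Q : B → Prop, {a // Q (g a)} ≃ g.ker × {b // Q b} := fun Q =>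
    { toFun := fun a => (⟨a.1 - s (g a.1), by simp [AddMonoidHom.mem_ker, hs (g a.1)]⟩,
        ⟨g a.1, a.2⟩)
      invFun := fun x => ⟨x.1.1 + s x.2.1, by
        have := x.1.2
        rw [AddMonoidHom.mem_ker] at this
        simpa [this, hs x.2.1] using x.2.2⟩
      left_inv := fun a => by simp
      right_inv := fun x => by
        have := x.1.2
        rw [AddMonoidHom.mem_ker] at this
        ext <;> simp [this, hs x.2.1] }
  have h1 := Nat.card_congr (e P)
  have h2 := Nat.card_congr (e fun _ => True)
  rw [Nat.card_prod] at h1 h2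
  have e3 : ∀ T : Type _, Nat.card {_x : T // True} = Nat.card T := fun T =>
    Nat.card_congr (Equiv.subtypeUnivEquiv fun _ => trivial)
  have e4 : Nat.card {_x : B // True} = Nat.card B :=
    Nat.card_congr (Equiv.subtypeUnivEquiv fun _ => trivial)
  rw [e3, e4] at h2
  rw [h1, h2]
  ring

theorem card_surjective_linearMap {K W : Type*} [Field K] [Fintype K] [AddCommGroup W]
    [Module K W] [Module.Finite K W] {n k : ℕ} (hW : Module.finrank K W = k) (hk : k ≤ n) :
    Nat.card {f : (Fin n → K) →ₗ[K] W // Function.Surjective f} =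
      ∏ i : Fin k, (Fintype.card K ^ n - Fintype.card K ^ i.val) := by
  classical
  have e : W ≃ₗ[K] (Fin k → K) := LinearEquiv.ofFinrankEq _ _ (by simp [hW])
  have h := card_linearIndependent (K := K) (V := Fin n → K) (k := k) (by simpa using hk)
  rw [Module.finrank_fintype_fun_eq_card, Fintype.card_fin] at h
  rw [← h]
  let E : ((Fin n → K) →ₗ[K] W) ≃ (Fin k → Fin n → K) :=
    (LinearEquiv.congrRight e).toEquiv.trans LinearMap.toMatrix'.toEquiv
  refine Nat.card_congr (E.subtypeEquiv fun f => ?_)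
  have h1 : Function.Surjective f ↔ Function.Surjective (e.toLinearMap.comp f) := by
    simp [LinearMap.coe_comp]
  rw [h1, linearIndependent_iff_card_eq_finrank_span, Set.finrank]
  have h2 := rank_eq_finrank_span_row (LinearMap.toMatrix' (e.toLinearMap.comp f))
  change _ ↔ Fintype.card (Fin k) = Module.finrank K (Submodule.span K
    (Set.range (LinearMap.toMatrix' (e.toLinearMap.comp f)).row))
  rw [← h2, Matrix.rank, ← Matrix.toLin'_apply', Matrix.toLin'_toMatrix', ← LinearMap.range_eq_top]
  constructor
  · intro h; rw [h]; simp
  · intro h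
    apply Submodule.eq_top_of_finrank_eq
    simp [← h]

theorem card_surjective_intPi_of_finrank (p : ℕ) [Fact p.Prime] {W : Type*}
    [AddCommGroup W] [Module (ZMod p) W] [Module.Finite (ZMod p) W] {n k : ℕ}
    (hW : Module.finrank (ZMod p) W = k) (hk : k ≤ n) :
    Nat.card {f : (Fin n → ℤ) →+ W // Function.Surjective f} =
      ∏ i : Fin k, (p ^ n - p ^ i.val) := by
  have := card_surjective_linearMap (K := ZMod p) hW hk
  rw [ZMod.card] at this
  rw [← this]
  let r : (Fin n → ℤ) →+ (Fin n → ZMod p) := (Int.castAddHom (ZMod p)).compLeft (Fin n)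
  have hr : Function.Surjective r := fun y => ⟨fun i => (y i).val, by
    ext i; simp [r]⟩
  have hsingle : ∀ i, r (Pi.single i 1) = Pi.single i 1 := fun i => by
    ext j; by_cases h : j = i <;> simp [r, h]
  symm
  let F : ((Fin n → ZMod p) →ₗ[ZMod p] W) → ((Fin n → ℤ) →+ W) := fun f => f.toAddMonoidHom.comp r
  have hF : Function.Bijective F := by
    constructor
    · intro f g h
      refine LinearMap.pi_ext' fun i => LinearMap.ext_ring ?_
      have := DFunLike.congr_fun h (Pi.single i 1)
      simpa [F, hsingle] using this
    · intro f
      refine ⟨Fintype.linearCombination (ZMod p) (fun i => f (Pi.single i 1)), ?_⟩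
      ext i
      simp [F, hsingle, Fintype.linearCombination_apply_single]
  refine Nat.card_congr ((Equiv.ofBijective F hF).subtypeEquiv fun f => ?_)
  simp only [Equiv.ofBijective_apply, F]
  exact ⟨fun h => h.comp hr, fun h => Function.Surjective.of_comp h⟩

theorem ZMod.exists_nsmul_of_castHom_eq_zero (p k : ℕ) [NeZero p] (hk : k ≠ 0) (x : ZMod (p ^ k))
    (h : ZMod.castHom (dvd_pow_self p hk) (ZMod p) x = 0) : ∃ c, x = p • c := by
  rw [ZMod.castHom_apply, ZMod.cast_eq_val, ZMod.natCast_eq_zero_iff] at h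
  obtain ⟨c, hc⟩ := h
  refine ⟨c, ?_⟩
  rw [← ZMod.natCast_zmod_val x, hc]
  simp

theorem card_nsmul_eq_zero_zmod (N d : ℕ) [NeZero N] :
    Nat.card {x : ZMod N // d • x = 0} = N.gcd d := by
  have := IsAddCyclic.card_nsmulAddMonoidHom_ker (ZMod N) d
  rw [Nat.card_zmod] at this
  exact this

/-- Reduction modulo `p` of the group `ℤ/p^k × (ℤ/p)^m`. -/
def reduceMod (p k m : ℕ) (hk : k ≠ 0) :
    ZMod (p ^ k) × (Fin m → ZMod p) →+ ZMod p × (Fin m → ZMod p) :=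
  (ZMod.castHom (dvd_pow_self p hk) (ZMod p)).toAddMonoidHom.prodMap (AddMonoidHom.id _)

theorem reduceMod_apply (p k m : ℕ) (hk : k ≠ 0) (x : ZMod (p ^ k) × (Fin m → ZMod p)) :
    reduceMod p k m hk x = (ZMod.castHom (dvd_pow_self p hk) (ZMod p) x.1, x.2) := rfl

theorem reduceMod_surjective (p k m : ℕ) (hk : k ≠ 0) :
    Function.Surjective (reduceMod p k m hk) := by
  rintro ⟨a, b⟩
  obtain ⟨x, rfl⟩ := ZMod.castHom_surjective (dvd_pow_self p hk) a
  exact ⟨(x, b), rfl⟩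

theorem comp_reduceMod_surjective_iff (p k m : ℕ) [NeZero p] (hk : k ≠ 0) {A : Type*}
    [AddCommGroup A] (f : A →+ ZMod (p ^ k) × (Fin m → ZMod p)) :
    Function.Surjective ((reduceMod p k m hk).comp f) ↔ Function.Surjective f := by
  refine f.comp_surjective_iff_of_nsmul _ p k ?_ (reduceMod_surjective p k m hk) ?_
  · rintro ⟨a, b⟩
    ext i
    · simp
    · simp [hk]
  · rintro ⟨a, b⟩ h
    rw [reduceMod_apply, Prod.mk_eq_zero] at h
    obtain ⟨c, hc⟩ := ZMod.exists_nsmul_of_castHom_eq_zero p k hk a h.1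
    refine ⟨(c, 0), ?_⟩
    ext i
    · simpa using hc
    · simpa using congrFun h.2 i

/-- The number of surjections `ℤ^n → ℤ/p^k × (ℤ/p)^m`. -/
theorem card_surjective_intPi (p k m n : ℕ) [Fact p.Prime] (hk : k ≠ 0) (hm : m + 1 ≤ n) :
    Nat.card {f : (Fin n → ℤ) →+ ZMod (p ^ k) × (Fin m → ZMod p) // Function.Surjective f} =
      p ^ ((k - 1) * n) * ∏ i : Fin (m + 1), (p ^ n - p ^ i.val) := by
  have hp : 0 < p := (Fact.out : p.Prime).pos
  have e : ∀ A : Type, [AddCommGroup A] → ((Fin n → ℤ) →+ A) ≃ (Fin n → A) := fun A _ =>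
    (addMonoidHomLequivInt (A := Fin n → ℤ) (B := A) ℤ).toEquiv.trans
      ((Pi.basisFun ℤ (Fin n)).constr ℤ).toEquiv.symm
  have hG : Nat.card ((Fin n → ℤ) →+ ZMod (p ^ k) × (Fin m → ZMod p)) = (p ^ k * p ^ m) ^ n := by
    rw [Nat.card_congr (e _)]; simp
  have hH : Nat.card ((Fin n → ℤ) →+ ZMod p × (Fin m → ZMod p)) = (p * p ^ m) ^ n := by
    rw [Nat.card_congr (e _)]; simp
  have : Finite ((Fin n → ℤ) →+ ZMod (p ^ k) × (Fin m → ZMod p)) := Finite.of_equiv _ (e _).symm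
  have : Finite ((Fin n → ℤ) →+ ZMod p × (Fin m → ZMod p)) := Finite.of_equiv _ (e _).symm
  let g : ((Fin n → ℤ) →+ ZMod (p ^ k) × (Fin m → ZMod p)) →+
      ((Fin n → ℤ) →+ ZMod p × (Fin m → ZMod p)) := AddMonoidHom.compHom (reduceMod p k m hk)
  have hg : Function.Surjective g := by
    intro f
    choose s hs using reduceMod_surjective p k m hk
    refine ⟨(((Pi.basisFun ℤ (Fin n)).constr ℤ) fun i => s (f (Pi.single i 1))).toAddMonoidHom, ?_⟩
    ext i : 2
    have h := (Pi.basisFun ℤ (Fin n)).constr_basis ℤ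
      (fun i => s (f (Pi.single i 1))) i
    rw [Pi.basisFun_apply] at h
    simp [g, h, hs]
  have h1 := g.card_subtype_comp_mul_card hg (fun f => Function.Surjective f)
  have h2 : Nat.card {f // Function.Surjective (g f)} =
      Nat.card {f : (Fin n → ℤ) →+ ZMod (p ^ k) × (Fin m → ZMod p) // Function.Surjective f} :=
    Nat.card_congr (Equiv.subtypeEquivRight fun f => comp_reduceMod_surjective_iff p k m hk f)
  rw [h2, hG, hH, card_surjective_intPi_of_finrank (W := ZMod p × (Fin m → ZMod p))
    (k := m + 1) p (by simp [add_comm]) hm] at h1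
  obtain ⟨j, rfl⟩ := Nat.exists_eq_succ_of_ne_zero hk
  have h3 : 0 < (p * p ^ m) ^ n := by positivity
  refine Nat.eq_of_mul_eq_mul_right h3 (h1.trans ?_)
  simp only [Nat.succ_eq_add_one, Nat.add_sub_cancel]
  ring

/-- The embedding `ℤ/p → ℤ/p^k` given by multiplication by `p^(k-1)`. -/
def socleEmb (p k : ℕ) (hk : k ≠ 0) : ZMod p →+ ZMod (p ^ k) :=
  ZMod.lift p ⟨zmultiplesHom _ ((p : ZMod (p ^ k)) ^ (k - 1)), by
    obtain ⟨j, rfl⟩ := Nat.exists_eq_succ_of_ne_zero hk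
    have : (p : ZMod (p ^ (j + 1))) * (p : ZMod (p ^ (j + 1))) ^ j = 0 := by
      rw [← pow_succ']; exact_mod_cast ZMod.natCast_self _
    simpa using this⟩

theorem socleEmb_natCast (p k : ℕ) (hk : k ≠ 0) (x : ℕ) :
    socleEmb p k hk (x : ZMod p) = ((x * p ^ (k - 1) : ℕ) : ZMod (p ^ k)) := by
  have := ZMod.lift_coe p ⟨zmultiplesHom _ ((p : ZMod (p ^ k)) ^ (k - 1)), by
    obtain ⟨j, rfl⟩ := Nat.exists_eq_succ_of_ne_zero hk
    have : (p : ZMod (p ^ (j + 1))) * (p : ZMod (p ^ (j + 1))) ^ j = 0 := by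
      rw [← pow_succ']; exact_mod_cast ZMod.natCast_self _
    simpa using this⟩ (x : ℤ)
  rw [Int.cast_natCast] at this
  rw [socleEmb, this]
  simp

theorem socleEmb_injective (p k : ℕ) [NeZero p] (hk : k ≠ 0) :
    Function.Injective (socleEmb p k hk) := by
  rw [injective_iff_map_eq_zero]
  intro x hx
  rw [← ZMod.natCast_zmod_val x] at hx ⊢
  rw [socleEmb_natCast, ZMod.natCast_eq_zero_iff] at hx
  obtain ⟨j, rfl⟩ := Nat.exists_eq_succ_of_ne_zero hk
  rw [ZMod.natCast_eq_zero_iff]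
  rw [Nat.succ_eq_add_one, Nat.add_sub_cancel, pow_succ'] at hx
  exact Nat.dvd_of_mul_dvd_mul_right (pow_pos (NeZero.pos p) j) hx

theorem exists_socleEmb_eq (p k : ℕ) [NeZero p] (hk : k ≠ 0) (y : ZMod (p ^ k))
    (hy : p • y = 0) : ∃ x, socleEmb p k hk x = y := by
  rw [← ZMod.natCast_zmod_val y] at hy ⊢
  generalize y.val = v at hy ⊢
  rw [nsmul_eq_mul, ← Nat.cast_mul, ZMod.natCast_eq_zero_iff] at hy
  obtain ⟨j, rfl⟩ := Nat.exists_eq_succ_of_ne_zero hk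
  rw [Nat.succ_eq_add_one, pow_succ'] at hy
  obtain ⟨c, hc⟩ := Nat.dvd_of_mul_dvd_mul_left (NeZero.pos p) hy
  refine ⟨(c : ZMod p), ?_⟩
  rw [socleEmb_natCast, hc, Nat.succ_eq_add_one, Nat.add_sub_cancel, mul_comm]

theorem castHom_socleEmb (p k : ℕ) [NeZero p] (hk : 2 ≤ k) (x : ZMod p) :
    ZMod.castHom (dvd_pow_self p (by omega : k ≠ 0)) (ZMod p) (socleEmb p k (by omega) x) = 0 := by
  rw [← ZMod.natCast_zmod_val x, socleEmb_natCast, map_natCast, ZMod.natCast_eq_zero_iff]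
  exact (dvd_pow_self p (by omega)).mul_left _

section Endomorphisms

variable (p k m : ℕ) [Fact p.Prime] (hk : 2 ≤ k)

/-- The endomorphism of `ℤ/p^k × (ℤ/p)^m` with the given matrix entries. -/
def blockEnd (x : (ZMod (p ^ k) × ((Fin m → ZMod p) →ₗ[ZMod p] (Fin m → ZMod p))) ×
      ((Fin m → ZMod p) × ((Fin m → ZMod p) →ₗ[ZMod p] ZMod p))) :
    ZMod (p ^ k) × (Fin m → ZMod p) →+ ZMod (p ^ k) × (Fin m → ZMod p) where
  toFun z := (z.1 * x.1.1 + socleEmb p k (by omega) (x.2.2 z.2),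
    ZMod.castHom (dvd_pow_self p (by omega : k ≠ 0)) (ZMod p) z.1 • x.2.1 + x.1.2 z.2)
  map_zero' := by simp
  map_add' z w := by
    simp only [Prod.fst_add, Prod.snd_add, map_add, add_mul, add_smul, Prod.mk_add_mk]
    congr 1 <;> abel

theorem blockEnd_apply (x : (ZMod (p ^ k) × ((Fin m → ZMod p) →ₗ[ZMod p] (Fin m → ZMod p))) ×
      ((Fin m → ZMod p) × ((Fin m → ZMod p) →ₗ[ZMod p] ZMod p)))
    (z : ZMod (p ^ k) × (Fin m → ZMod p)) :
    blockEnd p k m hk x z = (z.1 * x.1.1 + socleEmb p k (by omega) (x.2.2 z.2),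
    ZMod.castHom (dvd_pow_self p (by omega : k ≠ 0)) (ZMod p) z.1 • x.2.1 + x.1.2 z.2) := rfl

theorem blockEnd_bijective : Function.Bijective (blockEnd p k m hk) := by
  constructor
  · rintro ⟨⟨a, d⟩, c, b⟩ ⟨⟨a', d'⟩, c', b'⟩ h
    have h1 := DFunLike.congr_fun h (1, 0)
    have h2 := fun y => DFunLike.congr_fun h (0, y)
    simp only [blockEnd_apply, map_zero, map_one, one_mul, one_smul, add_zero, zero_mul, zero_add,
      zero_smul, Prod.mk.injEq] at h1 h2
    obtain ⟨rfl, rfl⟩ := h1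
    obtain rfl : d = d' := LinearMap.ext fun y => (h2 y).2
    obtain rfl : b = b' := LinearMap.ext fun y => socleEmb_injective _ _ _ (h2 y).1
    rfl
  · intro f
    have hb : ∀ y, ∃ x, socleEmb p k (by omega) x = (f (0, y)).1 := fun y => by
      refine exists_socleEmb_eq _ _ _ _ ?_
      change (p • f (0, y)).1 = 0
      rw [← map_nsmul]
      have : p • ((0, y) : ZMod (p ^ k) × (Fin m → ZMod p)) = 0 := by
        ext i <;> simp
      rw [this]; simp
    choose b hb using hb
    have hsplit : ∀ y z, f (0, y + z) = f (0, y) + f (0, z) := fun y z => by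
      rw [← map_add]; simp
    let b' : (Fin m → ZMod p) →+ ZMod p := AddMonoidHom.mk' b fun y z => by
      apply socleEmb_injective p k (by omega)
      rw [map_add, hb, hb, hb, hsplit]; rfl
    let d' : (Fin m → ZMod p) →+ (Fin m → ZMod p) :=
      AddMonoidHom.mk' (fun y => (f (0, y)).2) fun y z => by rw [hsplit]; rfl
    refine ⟨⟨⟨(f (1, 0)).1, d'.toZModLinearMap p⟩, (f (1, 0)).2, b'.toZModLinearMap p⟩, ?_⟩
    refine DFunLike.ext _ _ fun ⟨x, y⟩ => ?_
    have hx : f (x, y) = x.val • f (1, 0) + f (0, y) := by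
      rw [← map_nsmul, ← map_add]; simp
    rw [hx, blockEnd_apply]
    have hd : d'.toZModLinearMap p y = (f (0, y)).2 := rfl
    have hb2 : b'.toZModLinearMap p y = b y := rfl
    simp only [hd, hb2, hb]
    have hc : ZMod.castHom (dvd_pow_self p (by omega : k ≠ 0)) (ZMod p) x = (x.val : ZMod p) := by
      rw [ZMod.castHom_apply, ZMod.cast_eq_val]
    rw [hc, Nat.cast_smul_eq_nsmul]
    ext i
    · simp
    · simp

theorem blockEnd_surjective_iff
    (x : (ZMod (p ^ k) × ((Fin m → ZMod p) →ₗ[ZMod p] (Fin m → ZMod p))) ×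
      ((Fin m → ZMod p) × ((Fin m → ZMod p) →ₗ[ZMod p] ZMod p))) :
    Function.Surjective (blockEnd p k m hk x) ↔
      ZMod.castHom (dvd_pow_self p (by omega : k ≠ 0)) (ZMod p) x.1.1 ≠ 0 ∧
        Function.Surjective x.1.2 := by
  obtain ⟨⟨a, d⟩, c, b⟩ := x
  rw [← comp_reduceMod_surjective_iff p k m (by omega)]
  have happ : ∀ z, (reduceMod p k m (by omega)).comp (blockEnd p k m hk ⟨⟨a, d⟩, c, b⟩) z =
      (ZMod.castHom (dvd_pow_self p (by omega : k ≠ 0)) (ZMod p) z.1 *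
        ZMod.castHom (dvd_pow_self p (by omega : k ≠ 0)) (ZMod p) a,
        ZMod.castHom (dvd_pow_self p (by omega : k ≠ 0)) (ZMod p) z.1 • c + d z.2) := fun z => by
    rw [AddMonoidHom.comp_apply, reduceMod_apply, blockEnd_apply]
    simp only [map_add, map_mul, castHom_socleEmb p k hk, add_zero]
  constructor
  · intro h
    have ha : ZMod.castHom (dvd_pow_self p (by omega : k ≠ 0)) (ZMod p) a ≠ 0 := by
      intro h0
      obtain ⟨z, hz⟩ := h (1, 0)
      rw [happ, h0, mul_zero] at hz
      exact zero_ne_one (congrArg Prod.fst hz)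
    refine ⟨ha, fun v => ?_⟩
    obtain ⟨z, hz⟩ := h (0, v)
    rw [happ, Prod.mk.injEq, mul_eq_zero, or_iff_left ha] at hz
    exact ⟨z.2, by simpa [hz.1] using hz.2⟩
  · rintro ⟨ha, hd⟩ ⟨u, v⟩
    obtain ⟨x, hx⟩ := ZMod.castHom_surjective (dvd_pow_self p (by omega : k ≠ 0))
      (u * (ZMod.castHom (dvd_pow_self p (by omega : k ≠ 0)) (ZMod p) a)⁻¹)
    obtain ⟨y, hy⟩ := hd (v -
      ZMod.castHom (dvd_pow_self p (by omega : k ≠ 0)) (ZMod p) x • c)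
    refine ⟨(x, y), ?_⟩
    rw [happ]
    simp only [hy]
    rw [hx, inv_mul_cancel_right₀ ha, add_sub_cancel]

end Endomorphisms

/-- The number of automorphisms of `ℤ/p^k × (ℤ/p)^m`. -/
theorem card_surjective_end (p k m : ℕ) [Fact p.Prime] (hk : 2 ≤ k) :
    Nat.card {f : ZMod (p ^ k) × (Fin m → ZMod p) →+ ZMod (p ^ k) × (Fin m → ZMod p) //
        Function.Surjective f} =
      p ^ (k - 1) * (p - 1) * (∏ i : Fin m, (p ^ m - p ^ i.val)) * (p ^ m * p ^ m) := by
  have hp : 0 < p := (Fact.out : p.Prime).pos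
  have hk0 : k ≠ 0 := by omega
  have hunits : Nat.card {a : ZMod (p ^ k) //
      ZMod.castHom (dvd_pow_self p hk0) (ZMod p) a ≠ 0} = p ^ (k - 1) * (p - 1) := by
    have h := (ZMod.castHom (dvd_pow_self p hk0) (ZMod p)).toAddMonoidHom.card_subtype_comp_mul_card
      (ZMod.castHom_surjective (dvd_pow_self p hk0)) (fun a => a ≠ 0)
    have h2 : Nat.card {b : ZMod p // b ≠ 0} = p - 1 := by
      rw [Nat.card_eq_fintype_card, Fintype.card_subtype_compl]; simp
    rw [h2, Nat.card_zmod, Nat.card_zmod] at h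
    obtain ⟨j, rfl⟩ := Nat.exists_eq_succ_of_ne_zero hk0
    refine Nat.eq_of_mul_eq_mul_right hp (h.trans ?_)
    simp only [Nat.succ_eq_add_one, Nat.add_sub_cancel]
    ring
  have hdual : Nat.card ((Fin m → ZMod p) →ₗ[ZMod p] ZMod p) = p ^ m := by
    have : Finite ((Fin m → ZMod p) →ₗ[ZMod p] ZMod p) := Module.finite_of_finite (ZMod p)
    rw [Module.natCard_eq_pow_finrank (K := ZMod p)]; simp
  have hGL := card_surjective_linearMap (K := ZMod p) (W := Fin m → ZMod p) (n := m) (k := m)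
    (by simp) le_rfl
  rw [ZMod.card] at hGL
  rw [← Nat.card_congr ((Equiv.ofBijective _ (blockEnd_bijective p k m hk)).subtypeEquiv
    fun x => (blockEnd_surjective_iff p k m hk x).symm)]
  rw [Nat.card_congr (Equiv.prodSubtypeFstEquivSubtypeProd (p := fun y :
      ZMod (p ^ k) × ((Fin m → ZMod p) →ₗ[ZMod p] (Fin m → ZMod p)) =>
      ZMod.castHom (dvd_pow_self p hk0) (ZMod p) y.1 ≠ 0 ∧ Function.Surjective y.2)),
    Nat.card_prod, Nat.card_prod, hdual,
    Nat.card_congr (Equiv.subtypeProdEquivProd (p := fun a : ZMod (p ^ k) =>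
      ZMod.castHom (dvd_pow_self p hk0) (ZMod p) a ≠ 0)
      (q := fun d : (Fin m → ZMod p) →ₗ[ZMod p] (Fin m → ZMod p) => Function.Surjective d)),
    Nat.card_prod, hunits, hGL]
  simp

/-- Surjections onto a finite group are counted by their kernels and the automorphisms of the
target. -/
theorem card_surjective_eq_card_ker_mul {A G : Type*} [AddCommGroup A] [AddCommGroup G] [Finite G] :
    Nat.card {f : A →+ G // Function.Surjective f} =
      Nat.card {L : AddSubgroup A // ∃ f : A →+ G, Function.Surjective f ∧ f.ker = L} *
        Nat.card {f : G →+ G // Function.Surjective f} := by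
  rw [← Nat.card_prod]
  have hex : ∀ L : {L : AddSubgroup A // ∃ f : A →+ G, Function.Surjective f ∧ f.ker = L},
    ∃ f : A →+ G, Function.Surjective f ∧ f.ker = L := fun L => L.2
  choose φ hφ hker using hex
  symm
  refine Nat.card_eq_of_bijective (fun x => ⟨x.2.1.comp (φ x.1), x.2.2.comp (hφ x.1)⟩) ⟨?_, ?_⟩
  · rintro ⟨L, α, hα⟩ ⟨L', α', hα'⟩ h
    have h' : α.comp (φ L) = α'.comp (φ L') := congrArg Subtype.val h
    have hk : ∀ (L) (α : G →+ G) (hα : Function.Surjective α), (α.comp (φ L)).ker = L.1 := by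
      intro L α hα
      rw [← hker L, AddMonoidHom.ker_comp_of_injective]
      exact Finite.injective_iff_surjective.mpr hα
    obtain rfl : L = L' := Subtype.ext (by rw [← hk L α hα, h', hk L' α' hα'])
    obtain rfl : α = α' := AddMonoidHom.ext fun g => by
      obtain ⟨a, rfl⟩ := hφ L g
      exact DFunLike.congr_fun h' a
    rfl
  · rintro ⟨f, hf⟩
    let L : {L : AddSubgroup A // ∃ f : A →+ G, Function.Surjective f ∧ f.ker = L} :=
      ⟨f.ker, f, hf, rfl⟩
    let α := (φ L).liftOfSurjective (hφ L) ⟨f, (hker L).le⟩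
    have hα : α.comp (φ L) = f := (φ L).liftOfRightInverse_comp _ _ _
    refine ⟨⟨L, α, ?_⟩, Subtype.ext hα⟩
    intro g
    obtain ⟨a, rfl⟩ := hf g
    exact ⟨φ L a, DFunLike.congr_fun hα a⟩

theorem card_nsmul_eq_zero_pi_zmod {n p : ℕ} [NeZero p] (e : Fin n → ℕ) (k : ℕ) :
    Nat.card {x : ∀ i, ZMod (p ^ e i) // p ^ k • x = 0} = p ^ ∑ i, min (e i) k := by
  have E : {x : ∀ i, ZMod (p ^ e i) // p ^ k • x = 0} ≃
      ∀ i, {x : ZMod (p ^ e i) // p ^ k • x = 0} :=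
    (Equiv.subtypeEquivRight fun x => by simp [funext_iff]).trans Equiv.subtypePiEquivPi
  rw [Nat.card_congr E, Nat.card_pi, ← Finset.prod_pow_eq_pow_sum]
  refine Finset.prod_congr rfl fun i _ => ?_
  rw [card_nsmul_eq_zero_zmod]
  rcases le_total (e i) k with h | h
  · rw [min_eq_left h, Nat.gcd_eq_left (pow_dvd_pow p h)]
  · rw [min_eq_right h, Nat.gcd_eq_right (pow_dvd_pow p h)]

/-- The exponents of a finite abelian `p`-group in a decomposition into cyclic groups are unique
up to order. -/
theorem exists_perm_of_pi_zmod_addEquiv {n p : ℕ} [hp : Fact p.Prime] {e f : Fin n → ℕ}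
    (E : (∀ i, ZMod (p ^ e i)) ≃+ (∀ i, ZMod (p ^ f i))) :
    ∃ σ : Equiv.Perm (Fin n), ∀ i, f (σ i) = e i := by
  have hsum : ∀ k, ∑ i, min (e i) k = ∑ i, min (f i) k := fun k => by
    refine Nat.pow_right_injective hp.out.two_le ?_
    simp only
    rw [← card_nsmul_eq_zero_pi_zmod, ← card_nsmul_eq_zero_pi_zmod]
    exact Nat.card_congr (E.toEquiv.subtypeEquiv fun x => by
      change _ ↔ p ^ k • E x = 0
      rw [← map_nsmul, EmbeddingLike.map_eq_zero_iff])
  have hcount : ∀ k, ∑ i, (if e i = k then 1 else 0) = ∑ i, (if f i = k then 1 else 0) := by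
    have hz : ∀ g : Fin n → ℕ, ∑ i, (if g i = 0 then 1 else 0) + ∑ i, min (g i) 1 = n := by
      intro g
      rw [← Finset.sum_add_distrib, Finset.sum_congr rfl (g := fun _ => 1)]
      · simp
      · intro i _; split_ifs <;> omega
    have hs : ∀ (g : Fin n → ℕ) (k : ℕ), ∑ i, (if g i = k + 1 then 1 else 0) +
        ∑ i, min (g i) k + ∑ i, min (g i) (k + 2) = 2 * ∑ i, min (g i) (k + 1) := by
      intro g k
      rw [← Finset.sum_add_distrib, ← Finset.sum_add_distrib, Finset.mul_sum]
      refine Finset.sum_congr rfl fun i _ => ?_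
      split_ifs <;> omega
    rintro (_ | k)
    · have h1 := hz e
      have h2 := hz f
      have := hsum 1
      omega
    · have h1 := hs e k
      have h2 := hs f k
      have := hsum k
      have := hsum (k + 1)
      have := hsum (k + 2)
      omega
  refine ⟨Equiv.ofFiberEquiv (f := e) (g := f) fun k => Fintype.equivOfCardEq ?_,
    Equiv.ofFiberEquiv_map _⟩
  rw [Fintype.card_subtype, Fintype.card_subtype, Finset.card_filter, Finset.card_filter]
  exact hcount k

/-- Coordinates with respect to a basis `b`, the `i`-th one taken modulo `d i`. -/
noncomputable def Module.Basis.reprMod {n : ℕ} (b : Module.Basis (Fin n) ℤ (Fin n → ℤ))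
    (d : Fin n → ℕ) : (Fin n → ℤ) →+ ∀ i, ZMod (d i) where
  toFun x i := (b.repr x i : ZMod (d i))
  map_zero' := by ext; simp
  map_add' x y := by ext; simp

theorem Module.Basis.reprMod_surjective {n : ℕ} (b : Module.Basis (Fin n) ℤ (Fin n → ℤ))
    (d : Fin n → ℕ) : Function.Surjective (b.reprMod d) := by
  intro y
  choose z hz using fun i => ZMod.intCast_surjective (y i)
  refine ⟨∑ i, z i • b i, ?_⟩
  ext i
  change ((b.repr (∑ i, z i • b i) i : ℤ) : ZMod (d i)) = _
  rw [b.repr_sum_self, hz]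

theorem Module.Basis.mem_ker_reprMod {n : ℕ} (b : Module.Basis (Fin n) ℤ (Fin n → ℤ))
    (d : Fin n → ℕ) (x : Fin n → ℤ) :
    x ∈ (b.reprMod d).ker ↔ ∀ i, (d i : ℤ) ∣ b.repr x i := by
  rw [AddMonoidHom.mem_ker, funext_iff]
  exact forall_congr' fun i => ZMod.intCast_zmod_eq_zero_iff_dvd _ _

theorem exists_basis_ker_reprMod {n p : ℕ} [hp : Fact p.Prime] (f : Fin n → ℕ)
    (φ : (Fin n → ℤ) →+ ∀ i, ZMod (p ^ f i)) (hφ : Function.Surjective φ) :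
    ∃ b : Module.Basis (Fin n) ℤ (Fin n → ℤ), (b.reprMod fun i => p ^ f i).ker = φ.ker := by
  have E := QuotientAddGroup.quotientKerEquivOfSurjective φ hφ
  let N := AddSubgroup.toIntSubmodule φ.ker
  have hfin : Finite ((Fin n → ℤ) ⧸ N) := Finite.of_equiv _ E.toEquiv.symm
  rw [Submodule.finiteQuotient_iff] at hfin
  obtain ⟨b, a, ab, hab⟩ := N.exists_smith_normal_form_of_rank_eq (Pi.basisFun ℤ (Fin n)) hfin
  obtain ⟨d, hmem⟩ : ∃ d : Fin n → ℕ, (b.reprMod d).ker = φ.ker := by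
    refine ⟨fun i => (a i).natAbs, ?_⟩
    ext x
    rw [Module.Basis.mem_ker_reprMod]
    change _ ↔ x ∈ N
    simp_rw [ab.mem_submodule_iff', hab, Int.natAbs_dvd]
    have hc : ∀ (c : Fin n → ℤ) (i), b.repr (∑ j, c j • a j • b j) i = a i * c i := by
      intro c i
      simp only [← mul_smul, b.repr_sum_self, mul_comm]
    constructor
    · intro h
      choose c hc' using h
      exact ⟨c, b.ext_elem fun i => (hc' i).trans (hc c i).symm⟩
    · rintro ⟨c, rfl⟩ i
      exact ⟨c i, hc c i⟩
  have E' := (QuotientAddGroup.quotientKerEquivOfSurjective _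
    (b.reprMod_surjective d)).symm.trans
    ((QuotientAddGroup.quotientAddEquivOfEq hmem).trans E)
  have hpow : ∀ i, ∃ k, d i = p ^ k := by
    intro i
    have h0 : ∀ x : ∀ i, ZMod (d i), p ^ (∑ i, f i) • x = 0 := by
      intro x
      apply E'.injective
      rw [map_nsmul, map_zero]
      ext j
      have : p ^ f j ∣ p ^ ∑ i, f i :=
        pow_dvd_pow p (Finset.single_le_sum (f := f) (fun _ _ => Nat.zero_le _) (Finset.mem_univ j))
      rw [Pi.smul_apply, nsmul_eq_mul, (ZMod.natCast_eq_zero_iff _ _).mpr this]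
      simp
    have := congrFun (h0 fun _ => 1) i
    rw [Pi.smul_apply, nsmul_eq_mul, mul_one, Pi.zero_apply, ZMod.natCast_eq_zero_iff,
      Nat.dvd_prime_pow hp.out] at this
    obtain ⟨k, -, hk⟩ := this
    exact ⟨k, hk⟩
  choose e he using hpow
  obtain rfl : d = fun i => p ^ e i := funext he
  obtain ⟨σ, hσ⟩ := exists_perm_of_pi_zmod_addEquiv E'
  refine ⟨b.reindex σ, ?_⟩
  rw [← hmem]
  ext x
  rw [Module.Basis.mem_ker_reprMod, Module.Basis.mem_ker_reprMod, ← σ.forall_congr_right]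
  simp [hσ]

/-- The set of integer combinations of the rows of `h`. -/
def rowLattice {n : ℕ} (h : Matrix (Fin n) (Fin n) ℚ) : Set (Fin n → ℚ) :=
  {z | ∃ y : Fin n → ℤ, z = (fun i => (y i : ℚ)) ᵥ* h}

theorem mem_Lambda_iff_s7 {n : ℕ} {γ : Matrix (Fin n) (Fin n) ℚ} :
    γ ∈ Lambda n ↔ ∃ U : Matrix (Fin n) (Fin n) ℤ, IsUnit U.det ∧ toQ n U = γ := by
  have hdet : ∀ U : Matrix (Fin n) (Fin n) ℤ, (toQ n U).det = (U.det : ℚ) := fun U =>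
    ((Int.castRingHom ℚ).map_det U).symm
  constructor
  · rintro ⟨h, hd⟩
    choose U hU using h
    have hUγ : toQ n (Matrix.of U) = γ := by ext i j; exact (hU i j).symm
    refine ⟨Matrix.of U, ?_, hUγ⟩
    rw [← hUγ, hdet] at hd
    rw [Int.isUnit_iff]
    exact_mod_cast hd
  · rintro ⟨U, hU, rfl⟩
    refine ⟨fun i j => ⟨U i j, rfl⟩, ?_⟩
    rw [hdet]
    rw [Int.isUnit_iff] at hU
    exact_mod_cast hU

theorem toQ_mul {n : ℕ} (U W : Matrix (Fin n) (Fin n) ℤ) : toQ n (U * W) = toQ n U * toQ n W :=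
  Matrix.map_mul (f := Int.castRingHom ℚ)

theorem toQ_injective {n : ℕ} : Function.Injective (toQ n) :=
  Matrix.map_injective Int.cast_injective

theorem vecMul_toQ {n : ℕ} (y : Fin n → ℤ) (U : Matrix (Fin n) (Fin n) ℤ) :
    (fun i => (y i : ℚ)) ᵥ* toQ n U = fun i => ((y ᵥ* U) i : ℚ) := by
  ext i
  simp [vecMul, dotProduct, toQ]

theorem toQ_one (n : ℕ) : toQ n 1 = 1 :=
  Matrix.map_one _ Int.cast_zero Int.cast_one

theorem one_mem_Lambda (n : ℕ) : (1 : Matrix (Fin n) (Fin n) ℚ) ∈ Lambda n :=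
  mem_Lambda_iff_s7.mpr ⟨1, by simp, toQ_one n⟩

theorem rowLattice_mul_subset {n : ℕ} {γ : Matrix (Fin n) (Fin n) ℚ} (hγ : γ ∈ Lambda n)
    (h : Matrix (Fin n) (Fin n) ℚ) : rowLattice (γ * h) ⊆ rowLattice h := by
  obtain ⟨U, -, rfl⟩ := mem_Lambda_iff_s7.mp hγ
  rintro _ ⟨y, rfl⟩
  exact ⟨y ᵥ* U, by rw [← vecMul_vecMul, vecMul_toQ]⟩

theorem exists_eq_toQ_mul {n : ℕ} {h h' : Matrix (Fin n) (Fin n) ℚ}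
    (H : rowLattice h' ⊆ rowLattice h) : ∃ U, h' = toQ n U * h := by
  have hrow : ∀ i, ∃ y : Fin n → ℤ, h' i = (fun j => (y j : ℚ)) ᵥ* h := fun i =>
    H ⟨Pi.single i 1, by
      ext j
      simp [vecMul, dotProduct, Pi.single_apply]⟩
  choose U hU using hrow
  refine ⟨Matrix.of U, ?_⟩
  ext i j
  rw [hU]
  rfl

/-- Right cosets of invertible matrices are determined by the row lattice. -/
theorem rightCoset_eq_rightCoset_iff_s7 {n : ℕ} {h h' : Matrix (Fin n) (Fin n) ℚ} (hh : IsUnit h) :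
    rightCoset n h = rightCoset n h' ↔ rowLattice h = rowLattice h' := by
  have hself : ∀ h, h ∈ rightCoset n h := fun h => ⟨1, one_mem_Lambda n, by simp⟩
  constructor
  · intro H
    apply Set.Subset.antisymm
    · obtain ⟨γ, hγ, he⟩ : h ∈ rightCoset n h' := H ▸ hself h
      rw [he]
      exact rowLattice_mul_subset hγ h'
    · obtain ⟨γ, hγ, he⟩ : h' ∈ rightCoset n h := H ▸ hself h'
      rw [he]
      exact rowLattice_mul_subset hγ h
  · intro H
    obtain ⟨U, hU⟩ := exists_eq_toQ_mul H.le
    obtain ⟨W, hW⟩ := exists_eq_toQ_mul H.ge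
    have hone : toQ n (U * W) = 1 := by
      rw [toQ_mul]
      refine hh.mul_right_cancel ?_
      rw [one_mul, mul_assoc, ← hW, ← hU]
    have hUW : U * W = 1 := toQ_injective (hone.trans (toQ_one n).symm)
    have hUu : IsUnit U.det := (Matrix.isUnit_iff_isUnit_det U).mp (IsUnit.of_mul_eq_one W hUW)
    have hWu : IsUnit W.det := (Matrix.isUnit_iff_isUnit_det W).mp
      (IsUnit.of_mul_eq_one U (mul_eq_one_comm.mp hUW))
    have hmul : ∀ A B : Matrix (Fin n) (Fin n) ℤ, IsUnit A.det → IsUnit B.det →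
        IsUnit (A * B).det := fun A B hA hB => by rw [det_mul]; exact hA.mul hB
    apply Set.Subset.antisymm
    · rintro _ ⟨γ, hγ, rfl⟩
      obtain ⟨V, hV, rfl⟩ := mem_Lambda_iff_s7.mp hγ
      exact ⟨toQ n (V * U), mem_Lambda_iff_s7.mpr ⟨_, hmul _ _ hV hUu, rfl⟩, by
        rw [toQ_mul, mul_assoc, ← hU]⟩
    · rintro _ ⟨γ, hγ, rfl⟩
      obtain ⟨V, hV, rfl⟩ := mem_Lambda_iff_s7.mp hγ
      exact ⟨toQ n (V * W), mem_Lambda_iff_s7.mpr ⟨_, hmul _ _ hV hWu, rfl⟩, by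
        rw [toQ_mul, mul_assoc, ← hW]⟩

theorem isUnit_of_mem_Lambda {n : ℕ} {γ : Matrix (Fin n) (Fin n) ℚ} (hγ : γ ∈ Lambda n) :
    IsUnit γ := by
  rw [Matrix.isUnit_iff_isUnit_det, isUnit_iff_ne_zero]
  rcases hγ.2 with h | h <;> simp [h]

theorem toQ_of_basis_mem_Lambda {n : ℕ} (b : Module.Basis (Fin n) ℤ (Fin n → ℤ)) :
    toQ n (Matrix.of fun i => b i) ∈ Lambda n := by
  refine mem_Lambda_iff_s7.mpr ⟨_, ?_, rfl⟩
  have h := (Pi.basisFun ℤ (Fin n)).isUnit_det b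
  rw [Module.Basis.det_apply, ← Matrix.det_transpose] at h
  exact h

theorem exists_basis_of_isUnit_det {n : ℕ} {U : Matrix (Fin n) (Fin n) ℤ} (hU : IsUnit U.det) :
    ∃ b : Module.Basis (Fin n) ℤ (Fin n → ℤ), U = Matrix.of fun i => b i := by
  refine ⟨(Pi.basisFun ℤ (Fin n)).map (Matrix.toLinearEquivRight'OfInv
    (Matrix.nonsing_inv_mul U hU) (Matrix.mul_nonsing_inv U hU)), ?_⟩
  ext i j
  simp

theorem rowLattice_diagonal_mul_basis {n : ℕ} (b : Module.Basis (Fin n) ℤ (Fin n → ℤ))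
    (d : Fin n → ℕ) (c : ℚ) :
    rowLattice (Matrix.diagonal (fun i => c * (d i : ℚ)) * toQ n (Matrix.of fun i => b i)) =
      (fun x : Fin n → ℤ => fun i => c * (x i : ℚ)) '' ((b.reprMod d).ker : Set (Fin n → ℤ)) := by
  have key : ∀ y : Fin n → ℤ, (fun i => (y i : ℚ)) ᵥ*
      (Matrix.diagonal (fun i => c * (d i : ℚ)) * toQ n (Matrix.of fun i => b i)) =
      fun j => c * ((∑ i, (y i * d i) • b i) j : ℚ) := by
    intro y
    ext j
    rw [← vecMul_vecMul]
    simp [vecMul, dotProduct, toQ, Finset.mul_sum, Matrix.diagonal_apply]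
    refine Finset.sum_congr rfl fun i _ => ?_
    ring
  ext z
  constructor
  · rintro ⟨y, rfl⟩
    refine ⟨_, ?_, (key y).symm⟩
    rw [SetLike.mem_coe, Module.Basis.mem_ker_reprMod]
    intro i
    rw [b.repr_sum_self]
    exact dvd_mul_left _ _
  · rintro ⟨x, hx, rfl⟩
    rw [SetLike.mem_coe, Module.Basis.mem_ker_reprMod] at hx
    choose y hy using hx
    refine ⟨y, ?_⟩
    rw [key]
    have : ∑ i, (y i * d i) • b i = x := by
      rw [← b.sum_repr x]
      exact Finset.sum_congr rfl fun i _ => by rw [hy, mul_comm]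
    rw [this]

theorem rowLattice_mul_of_mem_Lambda {n : ℕ} {γ : Matrix (Fin n) (Fin n) ℚ} (hγ : γ ∈ Lambda n)
    (h : Matrix (Fin n) (Fin n) ℚ) : rowLattice (γ * h) = rowLattice h := by
  refine (rowLattice_mul_subset hγ h).antisymm ?_
  obtain ⟨U, hU, rfl⟩ := mem_Lambda_iff_s7.mp hγ
  rintro _ ⟨y, rfl⟩
  refine ⟨y ᵥ* U⁻¹, ?_⟩
  rw [← vecMul_vecMul, vecMul_toQ, vecMul_vecMul, Matrix.nonsing_inv_mul U hU, vecMul_one]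

/-- Right cosets in the double coset of `c • diag(p^f i)` correspond to the subgroups of `ℤ^n` with
quotient isomorphic to `∏ ℤ/p^f i`. -/
theorem degree_diagonal_eq_card {n p : ℕ} [hp : Fact p.Prime] (f : Fin n → ℕ) (c : ℚ)
    (hc : c ≠ 0) :
    degree n (Matrix.diagonal fun i => c * ((p ^ f i : ℕ) : ℚ)) =
      Nat.card {L : AddSubgroup (Fin n → ℤ) //
        ∃ φ : (Fin n → ℤ) →+ ∀ i, ZMod (p ^ f i), Function.Surjective φ ∧ φ.ker = L} := by
  set g := Matrix.diagonal fun i => c * ((p ^ f i : ℕ) : ℚ) with hg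
  have hgu : IsUnit g := by
    rw [Matrix.isUnit_iff_isUnit_det, isUnit_iff_ne_zero, hg, det_diagonal, Finset.prod_ne_zero_iff]
    intro i _
    have := hp.out.ne_zero
    positivity
  have hex : ∀ L : {L : AddSubgroup (Fin n → ℤ) //
      ∃ φ : (Fin n → ℤ) →+ ∀ i, ZMod (p ^ f i), Function.Surjective φ ∧ φ.ker = L},
      ∃ b : Module.Basis (Fin n) ℤ (Fin n → ℤ), (b.reprMod fun i => p ^ f i).ker = L.1 := by
    rintro ⟨_, φ, hφ, rfl⟩
    exact exists_basis_ker_reprMod f φ hφ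
  choose b hb using hex
  symm
  refine Nat.card_eq_of_bijective (fun L => ⟨rightCoset n (g * toQ n (Matrix.of fun i => b L i)),
    _, ⟨1, one_mem_Lambda n, _, toQ_of_basis_mem_Lambda (b L), by rw [one_mul]⟩, rfl⟩) ⟨?_, ?_⟩
  · intro L L' h
    have h' := (rightCoset_eq_rightCoset_iff_s7
      (hgu.mul (isUnit_of_mem_Lambda (toQ_of_basis_mem_Lambda (b L))))).mp
      (congrArg Subtype.val h)
    rw [rowLattice_diagonal_mul_basis, rowLattice_diagonal_mul_basis, hb, hb] at h'
    refine Subtype.ext (SetLike.coe_injective (Set.image_injective.mpr ?_ h'))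
    intro x y hxy
    ext i
    have := congrFun hxy i
    simpa [hc] using this
  · rintro ⟨_, h, ⟨γ₁, h₁, γ₂, h₂, rfl⟩, rfl⟩
    obtain ⟨U, hU, rfl⟩ := mem_Lambda_iff_s7.mp h₂
    obtain ⟨b', rfl⟩ := exists_basis_of_isUnit_det hU
    refine ⟨⟨(b'.reprMod fun i => p ^ f i).ker, _, b'.reprMod_surjective _, rfl⟩, Subtype.ext ?_⟩
    refine (rightCoset_eq_rightCoset_iff_s7
      (hgu.mul (isUnit_of_mem_Lambda (toQ_of_basis_mem_Lambda _)))).mpr ?_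
    rw [mul_assoc, rowLattice_mul_of_mem_Lambda h₁, rowLattice_diagonal_mul_basis,
      rowLattice_diagonal_mul_basis, hb]

theorem card_ker_congr {A G H : Type*} [AddCommGroup A] [AddCommGroup G] [AddCommGroup H]
    (e : G ≃+ H) :
    Nat.card {L : AddSubgroup A // ∃ f : A →+ G, Function.Surjective f ∧ f.ker = L} =
      Nat.card {L : AddSubgroup A // ∃ f : A →+ H, Function.Surjective f ∧ f.ker = L} := by
  refine Nat.card_congr (Equiv.subtypeEquivRight fun L => ⟨?_, ?_⟩)
  · rintro ⟨f, hf, rfl⟩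
    exact ⟨e.toAddMonoidHom.comp f, e.surjective.comp hf,
      AddMonoidHom.ker_comp_of_injective _ _ e.injective⟩
  · rintro ⟨f, hf, rfl⟩
    exact ⟨e.symm.toAddMonoidHom.comp f, e.symm.surjective.comp hf,
      AddMonoidHom.ker_comp_of_injective _ _ e.symm.injective⟩

/-- A product of cyclic `p`-groups with exponents `0, 0, 1, …, 1, k`. -/
theorem nonempty_addEquiv_of_exponents (p k m : ℕ) [NeZero p] (f : Fin (m + 3) → ℕ)
    (h0 : f 0 = 0) (h1 : f 1 = 0) (hlast : f (Fin.last (m + 2)) = k)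
    (hmid : ∀ j : Fin m, f j.castSucc.succ.succ = 1) :
    Nonempty ((∀ i, ZMod (p ^ f i)) ≃+ ZMod (p ^ k) × (Fin m → ZMod p)) := by
  have hl : p ^ f (Fin.last (m + 2)) = p ^ k := by rw [hlast]
  have hm : ∀ j : Fin m, p ^ f j.castSucc.succ.succ = p := fun j => by rw [hmid, pow_one]
  let F : (∀ i, ZMod (p ^ f i)) →+ ZMod (p ^ k) × (Fin m → ZMod p) :=
    { toFun := fun x => (ZMod.ringEquivCongr hl (x _), fun j => ZMod.ringEquivCongr (hm j) (x _))
      map_zero' := by ext <;> simp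
      map_add' := fun x y => by ext <;> simp }
  have hinj : Function.Injective F := by
    rw [injective_iff_map_eq_zero]
    intro x hx
    have hx1 : x (Fin.last (m + 2)) = 0 :=
      (EmbeddingLike.map_eq_zero_iff (f := ZMod.ringEquivCongr hl)).mp (congrArg Prod.fst hx)
    have hx2 : ∀ j : Fin m, x j.castSucc.succ.succ = 0 := fun j =>
      (EmbeddingLike.map_eq_zero_iff (f := ZMod.ringEquivCongr (hm j))).mp
        (congrFun (congrArg Prod.snd hx) j)
    have hx0 : ∀ i, f i = 0 → x i = 0 := fun i hi => by
      have : Subsingleton (ZMod (p ^ f i)) := by rw [hi, pow_zero]; infer_instance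
      exact Subsingleton.elim _ _
    ext i
    refine Fin.cases (hx0 0 h0) (fun i => Fin.cases (hx0 1 h1) (fun i => ?_) i) i
    exact Fin.lastCases hx1 hx2 i
  refine ⟨AddEquiv.ofBijective F (hinj.bijective_of_nat_card_le ?_)⟩
  rw [Nat.card_prod, Nat.card_pi, Nat.card_pi, Fin.prod_univ_succ, Fin.prod_univ_succ,
    Fin.prod_univ_castSucc]
  simp only [Nat.card_zmod, Fin.succ_last, hm, hl, h0, Fin.succ_zero_eq_one, h1]
  simp [mul_comm]

theorem prod_pow_sub_pow_mul (q : ℚ) (m : ℕ) :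
    (∏ i : Fin (m + 1), (q ^ (m + 3) - q ^ i.val)) * ((q - 1) * (q ^ 2 - 1)) =
      q ^ m * (q ^ (m + 1) - 1) * (q ^ (m + 2) - 1) * (q ^ (m + 3) - 1) *
        ∏ i : Fin m, (q ^ m - q ^ i.val) := by
  have hstep : ∀ a k : ℕ, ∏ i : Fin (k + 1), (q ^ (a + 1) - q ^ i.val) =
      (q ^ (a + 1) - 1) * q ^ k * ∏ i : Fin k, (q ^ a - q ^ i.val) := by
    intro a k
    rw [Fin.prod_univ_succ, mul_assoc]
    congr 1
    · simp
    · have : ∀ i : Fin k, q ^ (a + 1) - q ^ (i.succ).val = q * (q ^ a - q ^ i.val) := fun i => by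
        rw [Fin.val_succ]; ring
      simp_rw [this, Finset.prod_mul_distrib]
      simp
  induction m with
  | zero => simp; ring
  | succ m ih =>
    rw [hstep (m + 3) (m + 1), hstep m m]
    linear_combination (q ^ (m + 1 + 3) - 1) * q ^ (m + 1) * ih

theorem degree_diagonal_of_exponents (m p : ℕ) [hp : Fact p.Prime] (f : Fin (m + 3) → ℕ)
    (c : ℚ) (hc : c ≠ 0)
    (h0 : f 0 = 0) (h1 : f 1 = 0) (hlast : f (Fin.last (m + 2)) = 3)
    (hmid : ∀ j : Fin m, f j.castSucc.succ.succ = 1) :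
    (degree (m + 3) (Matrix.diagonal fun i => c * ((p ^ f i : ℕ) : ℚ)) : ℚ) =
      (p : ℚ) ^ (m + 4) * ((p : ℚ) ^ (m + 1) - 1) * ((p : ℚ) ^ (m + 2) - 1) *
        ((p : ℚ) ^ (m + 3) - 1) / (((p : ℚ) - 1) ^ 2 * ((p : ℚ) ^ 2 - 1)) := by
  obtain ⟨e⟩ := nonempty_addEquiv_of_exponents p 3 m f h0 h1 hlast hmid
  have hp1 : 1 < p := hp.out.one_lt
  have hq : (1 : ℚ) < p := by exact_mod_cast hp1
  have hcard := card_surjective_eq_card_ker_mul (A := Fin (m + 3) → ℤ)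
    (G := ZMod (p ^ 3) × (Fin m → ZMod p))
  rw [← card_ker_congr e, ← degree_diagonal_eq_card f c hc,
    card_surjective_intPi p 3 m (m + 3) (by norm_num) (by omega),
    card_surjective_end p 3 m (by norm_num)] at hcard
  generalize degree (m + 3) (Matrix.diagonal fun i => c * ((p ^ f i : ℕ) : ℚ)) = d at hcard ⊢
  have hcast : ∀ a b : ℕ, b ≤ a → ((∏ i : Fin b, (p ^ a - p ^ i.val) : ℕ) : ℚ) =
      ∏ i : Fin b, ((p : ℚ) ^ a - (p : ℚ) ^ i.val) := fun a b hab => by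
    rw [Nat.cast_prod]
    refine Finset.prod_congr rfl fun i _ => ?_
    rw [Nat.cast_sub (Nat.pow_le_pow_right hp1.le (by omega))]
    push_cast; rfl
  have hcard' := congrArg (Nat.cast : ℕ → ℚ) hcard
  simp only [Nat.cast_mul, hcast _ _ le_rfl, hcast (m + 3) (m + 1) (by omega), Nat.cast_pow,
    Nat.cast_sub hp1.le, Nat.cast_one] at hcard'
  have hA : ∏ i : Fin m, ((p : ℚ) ^ m - (p : ℚ) ^ i.val) ≠ 0 := by
    refine Finset.prod_ne_zero_iff.mpr fun i _ => (sub_pos.mpr ?_).ne'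
    exact pow_lt_pow_right₀ hq i.isLt
  have hid := prod_pow_sub_pow_mul (p : ℚ) m
  set A := ∏ i : Fin m, ((p : ℚ) ^ m - (p : ℚ) ^ i.val)
  set B := ∏ i : Fin (m + 1), ((p : ℚ) ^ (m + 3) - (p : ℚ) ^ i.val)
  set q : ℚ := (p : ℚ)
  have hq0 : q ≠ 0 := (zero_lt_one.trans hq).ne'
  have hq1 : q - 1 ≠ 0 := (sub_pos.mpr hq).ne'
  have hq2 : q ^ 2 - 1 ≠ 0 := (sub_pos.mpr (one_lt_pow₀ hq two_ne_zero)).ne'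
  rw [eq_div_iff (mul_ne_zero (pow_ne_zero 2 hq1) hq2)]
  refine mul_right_cancel₀ (mul_ne_zero (pow_ne_zero (2 * m + 2) hq0) hA) ?_
  have e1 : (3 - 1) * (m + 3) = 2 * m + 6 := by ring
  rw [e1, show 3 - 1 = 2 from rfl] at hcard'
  linear_combination (-(q - 1) * (q ^ 2 - 1)) * hcard' + q ^ (2 * m + 6) * hid

theorem statement7 (n p : ℕ) (hn : 4 ≤ n) (hp : p.Prime) :
    (degree n (Matrix.diagonal fun i : Fin n =>
      if i.val ≤ 1 then (p : ℚ) else if i.val = n - 1 then (p : ℚ) ^ 4 else (p : ℚ) ^ 2) : ℚ) =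
      (p : ℚ) ^ (n + 1) * ((p : ℚ) ^ (n - 2) - 1) * ((p : ℚ) ^ (n - 1) - 1) * ((p : ℚ) ^ n - 1)
        / (((p : ℚ) - 1) ^ 2 * ((p : ℚ) ^ 2 - 1)) := by
  have : Fact p.Prime := ⟨hp⟩
  obtain ⟨m, rfl⟩ : ∃ m, n = m + 3 := ⟨n - 3, by omega⟩
  have h := degree_diagonal_of_exponents m p
    (fun i => if i.val ≤ 1 then 0 else if i.val = m + 2 then 3 else 1)
    p (by exact_mod_cast hp.ne_zero) (by simp) (by simp) (by simp) (fun j => by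
      have := j.isLt
      simp [this.ne])
  convert h using 4
  · ext i
    simp only [show m + 3 - 1 = m + 2 from rfl]
    split_ifs <;> push_cast <;> ring
  · rfl
  · rfl
end
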